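/- arXiv:1607.06597 — 3 statements merged into one kernel-verified Lean document; each statement's English description precedes it below -/
import Mathlib

section
/- Let m ≥ 2 be an integer, let r > 1 be real, and let S be an aligned or offset double m-gon with radii 1 and r. Then every point q ∈ ℝ² with q ∉ S lies on at most m ordinary generalised circles determined by S. -/
noncomputable section

/-- A circle in the plane `ℝ² ≅ ℂ`: the set of points at a fixed positive
distance from a fixed centre. -/
def IsCircle (s : Set ℂ) : Prop :=
  ∃ (c : ℂ) (ρ : ℝ), 0 < ρ ∧ s = Metric.sphere c ρ

/-- A line in the plane `ℝ² ≅ ℂ`. -/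
def IsLine (s : Set ℂ) : Prop :=
  ∃ a d : ℂ, d ≠ 0 ∧ s = {z : ℂ | ∃ t : ℝ, z = a + t • d}

/-- A generalised circle is a circle or a line. -/
def IsGenCircle (s : Set ℂ) : Prop :=
  IsCircle s ∨ IsLine s

/-- The number of ordinary circles of a planar point set `P`:
circles containing exactly three points of `P`. -/
def ordinaryCircles (P : Set ℂ) : ℕ :=
  {C : Set ℂ | IsCircle C ∧ (C ∩ P).ncard = 3}.ncard

/-- The number of ordinary generalised circles of a planar point set `P`:
generalised circles containing exactly three points of `P`. -/
def ordinaryGenCircles (P : Set ℂ) : ℕ :=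
  {C : Set ℂ | IsGenCircle C ∧ (C ∩ P).ncard = 3}.ncard

/-- The number of 4-point generalised circles of a planar point set `P`:
generalised circles containing exactly four points of `P`. -/
def fourPointGenCircles (P : Set ℂ) : ℕ :=
  {C : Set ℂ | IsGenCircle C ∧ (C ∩ P).ncard = 4}.ncard

/-- The aligned double `m`-gon with radii `1` and `r`:
`{e^{2πik/m} : 0 ≤ k < m} ∪ {r·e^{2πik/m} : 0 ≤ k < m}`. -/
def alignedDoublePolygon (m : ℕ) (r : ℝ) : Set ℂ :=
  {z : ℂ | ∃ k : ℕ, k < m ∧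
    z = Complex.exp (((2 * Real.pi * (k : ℝ) / (m : ℝ) : ℝ) : ℂ) * Complex.I)} ∪
  {z : ℂ | ∃ k : ℕ, k < m ∧
    z = (r : ℂ) * Complex.exp (((2 * Real.pi * (k : ℝ) / (m : ℝ) : ℝ) : ℂ) * Complex.I)}

/-- The offset double `m`-gon with radii `1` and `r`:
`{e^{2πik/m} : 0 ≤ k < m} ∪ {r·e^{πi(2k+1)/m} : 0 ≤ k < m}`. -/
def offsetDoublePolygon (m : ℕ) (r : ℝ) : Set ℂ :=
  {z : ℂ | ∃ k : ℕ, k < m ∧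
    z = Complex.exp (((2 * Real.pi * (k : ℝ) / (m : ℝ) : ℝ) : ℂ) * Complex.I)} ∪
  {z : ℂ | ∃ k : ℕ, k < m ∧
    z = (r : ℂ) * Complex.exp (((Real.pi * (2 * (k : ℝ) + 1) / (m : ℝ) : ℝ) : ℂ) * Complex.I)}

/-- A nondegenerate real equation for a generalised circle. -/
theorem IsGenCircle.exists_equation {C : Set ℂ} (hC : IsGenCircle C) :
    ∃ A b g D : ℝ, ¬ (A = 0 ∧ b = 0 ∧ g = 0) ∧
      ∀ z : ℂ, z ∈ C ↔ A * (z.re ^ 2 + z.im ^ 2) + b * z.re + g * z.im + D = 0 := by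
  rcases hC with ⟨c, ρ, hρ, rfl⟩ | ⟨a, d, hd, rfl⟩
  · refine ⟨1, -2 * c.re, -2 * c.im, c.re ^ 2 + c.im ^ 2 - ρ ^ 2, by simp, fun z => ?_⟩
    rw [mem_sphere_iff_norm, ← sq_eq_sq₀ (norm_nonneg _) hρ.le, ← Complex.normSq_eq_norm_sq,
      Complex.normSq_apply, Complex.sub_re, Complex.sub_im]
    constructor <;> intro h <;> linear_combination h
  · have hd' : d.re ^ 2 + d.im ^ 2 ≠ 0 := by
      intro h
      apply hd
      apply Complex.ext <;> simp <;> nlinarith [sq_nonneg d.re, sq_nonneg d.im]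
    refine ⟨0, d.im, -d.re, a.im * d.re - a.re * d.im, ?_, fun z => ?_⟩
    · rintro ⟨-, h1, h2⟩
      apply hd'
      rw [h1, neg_eq_zero.mp h2]
      ring
    · constructor
      · rintro ⟨t, rfl⟩
        simp
        ring
      · intro h
        refine ⟨((z.re - a.re) * d.re + (z.im - a.im) * d.im) / (d.re ^ 2 + d.im ^ 2), ?_⟩
        apply Complex.ext
        · simp only [Complex.add_re, Complex.real_smul, Complex.re_ofReal_mul]
          field_simp
          linear_combination d.im * h
        · simp only [Complex.add_im, Complex.real_smul, Complex.im_ofReal_mul]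
          field_simp
          linear_combination -d.re * h

theorem norm_eq_iff_re_im {z : ℂ} {σ : ℝ} (hσ : 0 < σ) :
    ‖z‖ = σ ↔ z.re ^ 2 + z.im ^ 2 = σ ^ 2 := by
  rw [← sq_eq_sq₀ (norm_nonneg _) hσ.le, ← Complex.normSq_eq_norm_sq, Complex.normSq_apply]
  ring_nf

/-- A generalised circle sharing three points with a circle centred at the origin equals it. -/
theorem IsGenCircle.eq_sphere_of_three {C : Set ℂ} (hC : IsGenCircle C) {σ : ℝ} (hσ : 0 < σ)
    {x y z : ℂ} (hx : x ∈ C) (hy : y ∈ C) (hz : z ∈ C) (hxy : x ≠ y) (hxz : x ≠ z) (hyz : y ≠ z)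
    (nx : ‖x‖ = σ) (ny : ‖y‖ = σ) (nz : ‖z‖ = σ) : C = Metric.sphere 0 σ := by
  obtain ⟨A, b, g, D, hne, h⟩ := hC.exists_equation
  rw [h] at hx hy hz
  rw [norm_eq_iff_re_im hσ] at nx ny nz
  have key : b ^ 2 + g ^ 2 = 0 := by
    by_contra hbg
    have sep : ∀ u v : ℂ, A * (u.re ^ 2 + u.im ^ 2) + b * u.re + g * u.im + D = 0 →
        A * (v.re ^ 2 + v.im ^ 2) + b * v.re + g * v.im + D = 0 →
        u.re ^ 2 + u.im ^ 2 = σ ^ 2 → v.re ^ 2 + v.im ^ 2 = σ ^ 2 → u ≠ v →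
        (b * u.im - g * u.re) + (b * v.im - g * v.re) = 0 := by
      intro u v hu hv nu nv huv
      have hl : b * u.re + g * u.im = b * v.re + g * v.im := by
        linear_combination hu - hv - A * (nu - nv)
      have hprod : ((b * u.im - g * u.re) + (b * v.im - g * v.re)) *
          ((b * u.im - g * u.re) - (b * v.im - g * v.re)) = 0 := by
        linear_combination (b ^ 2 + g ^ 2) * (nu - nv)
          - (b * u.re + g * u.im + (b * v.re + g * v.im)) * hl
      rcases mul_eq_zero.mp hprod with h0 | h0
      · exact h0
      · exfalso
        apply huv
        apply Complex.ext <;> apply mul_left_cancel₀ hbg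
        · linear_combination b * hl - g * h0
        · linear_combination g * hl + b * h0
    have h1 := sep x y hx hy nx ny hxy
    have h2 := sep x z hx hz nx nz hxz
    have h3 := sep y z hy hz ny nz hyz
    apply hxy
    apply Complex.ext <;> apply mul_left_cancel₀ hbg
    · linear_combination b * (hx - hy - A * (nx - ny)) - g * (h2 - h3)
    · linear_combination g * (hx - hy - A * (nx - ny)) + b * (h2 - h3)
  have hb : b = 0 := by nlinarith [sq_nonneg b, sq_nonneg g]
  have hg : g = 0 := by nlinarith [sq_nonneg b, sq_nonneg g]
  subst hb hg
  have hA : A ≠ 0 := fun hA => hne ⟨hA, rfl, rfl⟩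
  ext w
  rw [h, mem_sphere_zero_iff_norm, norm_eq_iff_re_im hσ]
  constructor
  · intro hw
    apply mul_left_cancel₀ hA
    linear_combination hw - hx + A * nx
  · intro hw
    linear_combination A * (hw - nx) + hx

/-- The angle `πk/m`. -/
def gridAngle (m : ℕ) (k : ℤ) : ℝ := Real.pi * k / m

/-- The point with polar coordinates `(σ, πk/m)`. -/
def vertex (m : ℕ) (σ : ℝ) (k : ℤ) : ℂ := σ * Complex.exp ((gridAngle m k : ℂ) * Complex.I)

/-- The regular `m`-gon of radius `σ` at the angles `πk/m` with `k ≡ δ` modulo `2`. -/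
def polygon (m : ℕ) (σ : ℝ) (δ : ℤ) : Set ℂ := {z | ∃ k : ℤ, Even (k + δ) ∧ z = vertex m σ k}

/-- The generalised circle that passes through `vertex m σ w` and `vertex m ρ (w ± n)`; it is
tangent at the first point to the circle of radius `σ` centred at the origin. -/
def tangentCircle (m : ℕ) (σ ρ : ℝ) (w n : ℤ) : Set ℂ :=
  {z | (ρ ^ 2 - σ ^ 2) *
      (z.re * Real.cos (gridAngle m w) + z.im * Real.sin (gridAngle m w)) =
    σ * (ρ ^ 2 - ‖z‖ ^ 2) + ρ * (‖z‖ ^ 2 - σ ^ 2) * Real.cos (gridAngle m n)}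

theorem gridAngle_add (m : ℕ) (k l : ℤ) :
    gridAngle m (k + l) = gridAngle m k + gridAngle m l := by
  simp only [gridAngle]; push_cast; ring

theorem gridAngle_sub (m : ℕ) (k l : ℤ) :
    gridAngle m (k - l) = gridAngle m k - gridAngle m l := by
  simp only [gridAngle]; push_cast; ring

theorem gridAngle_neg (m : ℕ) (k : ℤ) : gridAngle m (-k) = -gridAngle m k := by
  simp only [gridAngle]; push_cast; ring

theorem gridAngle_period {m : ℕ} (hm : 0 < m) (k j : ℤ) :
    gridAngle m (k + 2 * m * j) = gridAngle m k + j * (2 * Real.pi) := by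
  have : (m : ℝ) ≠ 0 := by exact_mod_cast hm.ne'
  simp only [gridAngle]; push_cast; field_simp

theorem gridAngle_mul_self {m : ℕ} (hm : 0 < m) (j : ℤ) : gridAngle m (m * j) = j * Real.pi := by
  have : (m : ℝ) ≠ 0 := by exact_mod_cast hm.ne'
  simp only [gridAngle]; push_cast; field_simp

theorem gridAngle_injective {m : ℕ} (hm : 0 < m) : Function.Injective (gridAngle m) := by
  intro k l h
  have : (m : ℝ) ≠ 0 := by exact_mod_cast hm.ne'
  have hp := Real.pi_ne_zero
  simp only [gridAngle] at h
  field_simp at h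
  exact_mod_cast h

theorem cos_gridAngle_period {m : ℕ} (hm : 0 < m) (k j : ℤ) :
    Real.cos (gridAngle m (k + 2 * m * j)) = Real.cos (gridAngle m k) := by
  rw [gridAngle_period hm, Real.cos_add_int_mul_two_pi]

theorem sin_gridAngle_period {m : ℕ} (hm : 0 < m) (k j : ℤ) :
    Real.sin (gridAngle m (k + 2 * m * j)) = Real.sin (gridAngle m k) := by
  rw [gridAngle_period hm, Real.sin_add_int_mul_two_pi]

theorem gridAngle_mem_Ioo {m : ℕ} {n : ℤ} (h0 : 0 < n) (hn : n < m) :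
    0 < gridAngle m n ∧ gridAngle m n < Real.pi := by
  have hn0 : (0 : ℝ) < n := by exact_mod_cast h0
  have hnm : (n : ℝ) < m := by exact_mod_cast hn
  have hp := Real.pi_pos
  simp only [gridAngle]
  have hm0 := hn0.trans hnm
  refine ⟨by positivity, ?_⟩
  rw [div_lt_iff₀ hm0]
  nlinarith

theorem gridAngle_lt {m : ℕ} (hm : 0 < m) {k l : ℤ} : gridAngle m k < gridAngle m l ↔ k < l := by
  have hm' : (0 : ℝ) < m := by exact_mod_cast hm
  simp only [gridAngle]
  rw [div_lt_div_iff_of_pos_right hm', mul_lt_mul_iff_right₀ Real.pi_pos, Int.cast_lt]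

theorem cos_gridAngle_lt {m : ℕ} {k l : ℤ} (hk : 0 ≤ k) (hkl : k < l) (hl : l ≤ m) :
    Real.cos (gridAngle m l) < Real.cos (gridAngle m k) := by
  have hm : 0 < m := by omega
  have hm' : (0 : ℝ) < m := by exact_mod_cast hm
  have hk' : (0 : ℝ) ≤ k := by exact_mod_cast hk
  have hl' : (l : ℝ) ≤ m := by exact_mod_cast hl
  have hp := Real.pi_pos
  apply Real.cos_lt_cos_of_nonneg_of_le_pi
  · simp only [gridAngle]; positivity
  · simp only [gridAngle]
    rw [div_le_iff₀ hm']
    nlinarith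
  · exact (gridAngle_lt hm).mpr hkl

theorem vertex_re (m : ℕ) (σ : ℝ) (k : ℤ) :
    (vertex m σ k).re = σ * Real.cos (gridAngle m k) := by
  rw [vertex, Complex.re_ofReal_mul, Complex.exp_ofReal_mul_I_re]

theorem vertex_im (m : ℕ) (σ : ℝ) (k : ℤ) :
    (vertex m σ k).im = σ * Real.sin (gridAngle m k) := by
  rw [vertex, Complex.im_ofReal_mul, Complex.exp_ofReal_mul_I_im]

theorem norm_vertex (m : ℕ) {σ : ℝ} (hσ : 0 < σ) (k : ℤ) : ‖vertex m σ k‖ = σ := by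
  rw [vertex, norm_mul, Complex.norm_exp_ofReal_mul_I, mul_one, Complex.norm_real,
    Real.norm_of_nonneg hσ.le]

theorem vertex_period {m : ℕ} (hm : 0 < m) (σ : ℝ) (k j : ℤ) :
    vertex m σ (k + 2 * m * j) = vertex m σ k := by
  apply Complex.ext
  · rw [vertex_re, vertex_re, cos_gridAngle_period hm]
  · rw [vertex_im, vertex_im, sin_gridAngle_period hm]

theorem exists_eq_of_vertex_eq {m : ℕ} (hm : 0 < m) {σ : ℝ} (hσ : 0 < σ) {k l : ℤ}
    (h : vertex m σ k = vertex m σ l) : ∃ j : ℤ, k = l + 2 * m * j := by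
  have hσ' : (σ : ℂ) ≠ 0 := by exact_mod_cast hσ.ne'
  have h1 := mul_left_cancel₀ hσ' h
  obtain ⟨j, hj⟩ := Complex.exp_eq_exp_iff_exists_int.mp h1
  refine ⟨j, gridAngle_injective hm ?_⟩
  rw [gridAngle_period hm]
  have h2 : ((gridAngle m k : ℂ)) = gridAngle m l + j * (2 * Real.pi) := by
    apply mul_right_cancel₀ Complex.I_ne_zero
    linear_combination hj
  exact_mod_cast h2

theorem polygon_norm {m : ℕ} {σ : ℝ} (hσ : 0 < σ) {δ : ℤ} {z : ℂ} (hz : z ∈ polygon m σ δ) :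
    ‖z‖ = σ := by
  obtain ⟨k, -, rfl⟩ := hz
  exact norm_vertex m hσ k

theorem tangentCircle_period {m : ℕ} (hm : 0 < m) (σ ρ : ℝ) (w n j : ℤ) :
    tangentCircle m σ ρ (w + 2 * m * j) n = tangentCircle m σ ρ w n := by
  simp only [tangentCircle, cos_gridAngle_period hm, sin_gridAngle_period hm]

/-- Reduction of an integer modulo `2m` and sign to the interval `(0, m)`. -/
theorem exists_reduced {m : ℕ} (hm : 0 < m) {y : ℤ} (hy : ¬ (m : ℤ) ∣ y) :
    ∃ x j : ℤ, 0 < x ∧ x < m ∧ (y = x + 2 * m * j ∨ y = -x + 2 * m * j) := by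
  have h1 := Int.emod_add_mul_ediv y (2 * m)
  have h2 := Int.emod_nonneg y (show (2 * m : ℤ) ≠ 0 by omega)
  have h3 := Int.emod_lt_of_pos y (show (0 : ℤ) < 2 * m by omega)
  set a := y % (2 * m) with ha
  set b := y / (2 * m) with hb
  have ha0 : a ≠ 0 := fun h => hy ⟨2 * b, by rw [← h1, h]; ring⟩
  have ham : a ≠ m := fun h => hy ⟨1 + 2 * b, by rw [← h1, h]; ring⟩
  rcases lt_or_gt_of_ne ham with h | h
  · exact ⟨a, b, by omega, h, Or.inl h1.symm⟩
  · exact ⟨2 * m - a, b + 1, by omega, by omega, Or.inr (by linear_combination -h1)⟩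

/-- A generalised circle through two points of a polygon is symmetric about their bisector. -/
theorem IsGenCircle.reflect_mem {C : Set ℂ} (hC : IsGenCircle C) {m : ℕ} {ρ σ : ℝ} (hρ : 0 < ρ)
    {u v w : ℤ} (hu : vertex m ρ u ∈ C) (hv : vertex m ρ v ∈ C)
    (huv : vertex m ρ u ≠ vertex m ρ v) (hw : vertex m σ w ∈ C) :
    vertex m σ (u + v - w) ∈ C := by
  obtain ⟨A, b, g, D, -, h⟩ := hC.exists_equation
  rw [h, vertex_re, vertex_im] at hu hv hw ⊢
  set M := (gridAngle m u + gridAngle m v) / 2 with hM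
  set d := (gridAngle m u - gridAngle m v) / 2 with hd
  set f := gridAngle m w - M with hf
  have e1 : gridAngle m u = M + d := by rw [hM, hd]; ring
  have e2 : gridAngle m v = M - d := by rw [hM, hd]; ring
  have e3 : gridAngle m w = M + f := by rw [hf]; ring
  have e4 : gridAngle m (u + v - w) = M - f := by
    rw [gridAngle_sub, gridAngle_add, hf, hM]; ring
  clear_value f d M
  have hsd : Real.sin d ≠ 0 := by
    intro hs
    apply huv
    apply Complex.ext
    · rw [vertex_re, vertex_re, e1, e2, Real.cos_add, Real.cos_sub, hs]; ring
    · rw [vertex_im, vertex_im, e1, e2, Real.sin_add, Real.sin_sub, hs]; ring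
  rw [e1, Real.cos_add, Real.sin_add] at hu
  rw [e2, Real.cos_sub, Real.sin_sub] at hv
  rw [e3, Real.cos_add, Real.sin_add] at hw
  rw [e4, Real.cos_sub, Real.sin_sub]
  have hperp : g * Real.cos M - b * Real.sin M = 0 := by
    have : (2 * ρ * Real.sin d) * (g * Real.cos M - b * Real.sin M) = 0 := by
      linear_combination hu - hv
    rcases mul_eq_zero.mp this with h0 | h0
    · exact absurd h0 (by positivity)
    · exact h0
  linear_combination hw - 2 * σ * Real.sin f * hperp

theorem IsGenCircle.eq_tangentCircle {C : Set ℂ} (hC : IsGenCircle C) {m : ℕ} {ρ σ : ℝ}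
    (hρ : 0 < ρ) (hσ : 0 < σ) (hρσ : ρ ≠ σ) {w n : ℤ} (hn0 : 0 < n) (hnm : n < m)
    (hw : vertex m σ w ∈ C) (h1 : vertex m ρ (w + n) ∈ C) (h2 : vertex m ρ (w - n) ∈ C) :
    C = tangentCircle m σ ρ w n := by
  obtain ⟨A, b, g, D, hne, h⟩ := hC.exists_equation
  rw [h, vertex_re, vertex_im] at hw h1 h2
  rw [gridAngle_add, Real.cos_add, Real.sin_add] at h1
  rw [gridAngle_sub, Real.cos_sub, Real.sin_sub] at h2
  have hsin : 0 < Real.sin (gridAngle m n) :=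
    Real.sin_pos_of_pos_of_lt_pi (gridAngle_mem_Ioo hn0 hnm).1 (gridAngle_mem_Ioo hn0 hnm).2
  have hq : ρ ^ 2 - σ ^ 2 ≠ 0 := by
    intro h0
    apply hρσ
    nlinarith
  simp only [tangentCircle]
  set c := Real.cos (gridAngle m w)
  set s := Real.sin (gridAngle m w)
  set c' := Real.cos (gridAngle m n)
  set s' := Real.sin (gridAngle m n)
  have tw : s ^ 2 + c ^ 2 = 1 := Real.sin_sq_add_cos_sq _
  have tn : s' ^ 2 + c' ^ 2 = 1 := Real.sin_sq_add_cos_sq _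
  have hperp : g * c - b * s = 0 := by
    have : (2 * ρ * s') * (g * c - b * s) = 0 := by linear_combination h1 - h2
    rcases mul_eq_zero.mp this with h0 | h0
    · exact absurd h0 (by positivity)
    · exact h0
  set β := b * c + g * s with hβ
  have hb : b = β * c := by rw [hβ]; linear_combination (-s) * hperp - b * tw
  have hg : g = β * s := by rw [hβ]; linear_combination c * hperp - g * tw
  have k1 : A * σ ^ 2 + β * σ + D = 0 := by rw [hβ]; linear_combination hw - A * σ ^ 2 * tw
  have k2 : A * ρ ^ 2 + ρ * c' * β + D = 0 := by
    rw [hβ]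
    linear_combination (h1 + h2) / 2 - A * ρ ^ 2 * (c' ^ 2 + s' ^ 2) * tw - A * ρ ^ 2 * tn
  have hA : A * (ρ ^ 2 - σ ^ 2) = β * (σ - ρ * c') := by linear_combination k2 - k1
  have hβ0 : β ≠ 0 := by
    intro h0
    rw [h0] at hA hb hg
    refine hne ⟨?_, by rw [hb]; ring, by rw [hg]; ring⟩
    rw [zero_mul] at hA
    exact (mul_eq_zero.mp hA).resolve_right hq
  ext z
  have hz : ‖z‖ ^ 2 = z.re ^ 2 + z.im ^ 2 := by
    rw [← Complex.normSq_eq_norm_sq, Complex.normSq_apply]; ring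
  rw [h, Set.mem_ofPred_eq, hz, hb, hg]
  constructor
  · intro hz'
    apply mul_left_cancel₀ hβ0
    linear_combination (ρ ^ 2 - σ ^ 2) * (hz' - k1) - (z.re ^ 2 + z.im ^ 2 - σ ^ 2) * hA
  · intro hz'
    apply mul_left_cancel₀ hq
    linear_combination β * hz' + (ρ ^ 2 - σ ^ 2) * k1 + (z.re ^ 2 + z.im ^ 2 - σ ^ 2) * hA

/-- The generalised circles through `q` tangent at a vertex of `polygon m σ δ` to the circle of
radius `σ` and meeting `polygon m ρ δ'` in a mirror pair. -/
def tangentCirclesThrough (m : ℕ) (σ ρ : ℝ) (δ δ' : ℤ) (q : ℂ) : Set (Set ℂ) :=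
  {C | q ∈ C ∧ ∃ w n : ℤ, Even (w + δ) ∧ Even (n + δ + δ') ∧ 0 < n ∧ n < m ∧
    C = tangentCircle m σ ρ w n}

theorem mem_tangentCirclesThrough {m : ℕ} (hm : 0 < m) {σ ρ : ℝ} (hσ : 0 < σ) (hρ : 0 < ρ)
    (hσρ : σ ≠ ρ) {δ δ' : ℤ} {q : ℂ} {C : Set ℂ} (hC : IsGenCircle C) (hq : q ∈ C)
    {x y z : ℂ} (hxy : x ≠ y) (hx : x ∈ polygon m ρ δ') (hy : y ∈ polygon m ρ δ')
    (hz : z ∈ polygon m σ δ) (hCS : C ∩ (polygon m ρ δ' ∪ polygon m σ δ) = {x, y, z}) :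
    C ∈ tangentCirclesThrough m σ ρ δ δ' q := by
  have hxC : x ∈ C := (hCS.ge (by simp : x ∈ ({x, y, z} : Set ℂ))).1
  have hyC : y ∈ C := (hCS.ge (by simp : y ∈ ({x, y, z} : Set ℂ))).1
  have hzC : z ∈ C := (hCS.ge (by simp : z ∈ ({x, y, z} : Set ℂ))).1
  obtain ⟨u, hu, rfl⟩ := hx
  obtain ⟨v, hv, rfl⟩ := hy
  obtain ⟨w, hw, rfl⟩ := hz
  have hr := hC.reflect_mem hρ hxC hyC hxy hzC
  have hrS : vertex m σ (u + v - w) ∈ polygon m σ δ :=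
    ⟨u + v - w, by rw [Int.even_iff] at *; omega, rfl⟩
  have hmem : vertex m σ (u + v - w) ∈ ({vertex m ρ u, vertex m ρ v, vertex m σ w} : Set ℂ) :=
    hCS.le ⟨hr, Or.inr hrS⟩
  have hfix : vertex m σ (u + v - w) = vertex m σ w := by
    simp only [Set.mem_insert_iff, Set.mem_singleton_iff] at hmem
    rcases hmem with h | h | h
    · have := congrArg norm h
      rw [norm_vertex m hσ, norm_vertex m hρ] at this
      exact absurd this hσρ
    · have := congrArg norm h
      rw [norm_vertex m hσ, norm_vertex m hρ] at this
      exact absurd this hσρ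
    · exact h
  obtain ⟨j, hj⟩ := exists_eq_of_vertex_eq hm hσ hfix
  have hv' : v = w - (u - w) + 2 * m * j := by linear_combination hj
  have hndvd : ¬ (m : ℤ) ∣ u - w := by
    rintro ⟨k, hk⟩
    apply hxy
    have : u = v + 2 * m * (k - j) := by rw [hv']; linear_combination 2 * hk
    rw [this, vertex_period hm]
  have hvy : vertex m ρ v = vertex m ρ (w - (u - w)) := by rw [hv', vertex_period hm]
  obtain ⟨n, k, hn0, hnm, hn | hn⟩ := exists_reduced hm hndvd
  · have hux : vertex m ρ u = vertex m ρ (w + n) := by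
      rw [← vertex_period hm ρ (w + n) k]; congr 1; linear_combination hn
    have hvy' : vertex m ρ v = vertex m ρ (w - n) := by
      rw [hvy, ← vertex_period hm ρ (w - n) (-k)]; congr 1; linear_combination -hn
    refine ⟨hq, w, n, hw, ?_, hn0, hnm, hC.eq_tangentCircle hρ hσ hσρ.symm hn0 hnm hzC
      (hux ▸ hxC) (hvy' ▸ hyC)⟩
    rw [show n + δ + δ' = (u + δ') - (w + δ) + 2 * (δ - m * k) by linear_combination -hn]
    exact (hu.sub hw).add (even_two_mul _)
  · have hux : vertex m ρ u = vertex m ρ (w - n) := by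
      rw [← vertex_period hm ρ (w - n) k]; congr 1; linear_combination hn
    have hvy' : vertex m ρ v = vertex m ρ (w + n) := by
      rw [hvy, ← vertex_period hm ρ (w + n) (-k)]; congr 1; linear_combination -hn
    refine ⟨hq, w, n, hw, ?_, hn0, hnm, hC.eq_tangentCircle hρ hσ hσρ.symm hn0 hnm hzC
      (hvy' ▸ hyC) (hux ▸ hxC)⟩
    rw [show n + δ + δ' = (w + δ) - (u + δ') + 2 * (δ' + m * k) by linear_combination hn]
    exact (hw.sub hu).add (even_two_mul _)

/-- Classification of the ordinary generalised circles of a union of two concentric polygons. -/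
theorem ordinary_classification {m : ℕ} (hm : 0 < m) {σ ρ : ℝ} (hσ : 0 < σ) (hρ : 0 < ρ)
    (hσρ : σ ≠ ρ) {δ δ' : ℤ} {q : ℂ} {C : Set ℂ} (hC : IsGenCircle C) (hq : q ∈ C)
    (h3 : (C ∩ (polygon m σ δ ∪ polygon m ρ δ')).ncard = 3) :
    C = Metric.sphere 0 σ ∨ C = Metric.sphere 0 ρ ∨
      C ∈ tangentCirclesThrough m σ ρ δ δ' q ∨ C ∈ tangentCirclesThrough m ρ σ δ' δ q := by
  obtain ⟨x, y, z, hxy, hxz, hyz, hS⟩ := Set.ncard_eq_three.mp h3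
  have hx : x ∈ C ∩ (polygon m σ δ ∪ polygon m ρ δ') := by rw [hS]; simp
  have hy : y ∈ C ∩ (polygon m σ δ ∪ polygon m ρ δ') := by rw [hS]; simp
  have hz : z ∈ C ∩ (polygon m σ δ ∪ polygon m ρ δ') := by rw [hS]; simp
  have hxzy : ({x, y, z} : Set ℂ) = {x, z, y} := by rw [Set.pair_comm y z]
  have hyzx : ({x, y, z} : Set ℂ) = {y, z, x} := by
    rw [Set.insert_comm, Set.pair_comm x z]
  have hS' : C ∩ (polygon m ρ δ' ∪ polygon m σ δ) = {x, y, z} := by rw [Set.union_comm, hS]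
  obtain ⟨hxC, hx⟩ := hx
  obtain ⟨hyC, hy⟩ := hy
  obtain ⟨hzC, hz⟩ := hz
  rcases hx with hx | hx <;> rcases hy with hy | hy <;> rcases hz with hz | hz
  · exact Or.inl (hC.eq_sphere_of_three hσ hxC hyC hzC hxy hxz hyz (polygon_norm hσ hx)
      (polygon_norm hσ hy) (polygon_norm hσ hz))
  · exact Or.inr (Or.inr (Or.inr
      (mem_tangentCirclesThrough hm hρ hσ hσρ.symm hC hq hxy hx hy hz hS)))
  · exact Or.inr (Or.inr (Or.inr
      (mem_tangentCirclesThrough hm hρ hσ hσρ.symm hC hq hxz hx hz hy (hS.trans hxzy))))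
  · exact Or.inr (Or.inr (Or.inl
      (mem_tangentCirclesThrough hm hσ hρ hσρ hC hq hyz hy hz hx (hS'.trans hyzx))))
  · exact Or.inr (Or.inr (Or.inr
      (mem_tangentCirclesThrough hm hρ hσ hσρ.symm hC hq hyz hy hz hx (hS.trans hyzx))))
  · exact Or.inr (Or.inr (Or.inl
      (mem_tangentCirclesThrough hm hσ hρ hσρ hC hq hxz hx hz hy (hS'.trans hxzy))))
  · exact Or.inr (Or.inr (Or.inl
      (mem_tangentCirclesThrough hm hσ hρ hσρ hC hq hxy hx hy hz hS')))
  · exact Or.inr (Or.inl (hC.eq_sphere_of_three hρ hxC hyC hzC hxy hxz hyz (polygon_norm hρ hx)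
      (polygon_norm hρ hy) (polygon_norm hρ hz)))

theorem ncard_le_card_of_relation {α β : Type*} [Nonempty β] (R : α → β → Prop) {s : Set α} {t : Finset β}
    (hR : ∀ a ∈ s, ∃ b ∈ t, R a b)
    (inj : ∀ a ∈ s, ∀ a' ∈ s, ∀ b ∈ t, R a b → R a' b → a = a') :
    s.Finite ∧ s.ncard ≤ t.card := by
  choose! f hf hRf using hR
  have hmaps : Set.MapsTo f s t := hf
  have hinj : Set.InjOn f s := fun a ha a' ha' h =>
    inj a ha a' ha' (f a) (hf a ha) (hRf a ha) (h ▸ hRf a' ha')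
  refine ⟨Set.Finite.of_injOn hmaps hinj t.finite_toSet, ?_⟩
  rw [← Set.ncard_coe_finset t]
  exact Set.ncard_le_ncard_of_injOn f hmaps hinj t.finite_toSet

theorem mem_tangentCircle_iff (m : ℕ) (σ ρ : ℝ) (w n : ℤ) (q : ℂ) :
    q ∈ tangentCircle m σ ρ w n ↔
      (ρ ^ 2 - σ ^ 2) * (‖q‖ * Real.cos (q.arg - gridAngle m w)) =
        σ * (ρ ^ 2 - ‖q‖ ^ 2) + ρ * (‖q‖ ^ 2 - σ ^ 2) * Real.cos (gridAngle m n) := by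
  rw [tangentCircle, Set.mem_ofPred_eq, Real.cos_sub, mul_add ‖q‖, ← mul_assoc ‖q‖,
    ← mul_assoc ‖q‖, Complex.norm_mul_cos_arg, Complex.norm_mul_sin_arg]

theorem eq_vertex_of_arg {m : ℕ} {σ : ℝ} {q : ℂ} (hq : ‖q‖ = σ) {k j : ℤ}
    (h : q.arg = gridAngle m k + j * (2 * Real.pi)) : q = vertex m σ k := by
  apply Complex.ext
  · rw [vertex_re, ← Complex.norm_mul_cos_arg, hq, h, Real.cos_add_int_mul_two_pi]
  · rw [vertex_im, ← Complex.norm_mul_sin_arg, hq, h, Real.sin_add_int_mul_two_pi]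

theorem tangentCirclesThrough_eq_empty_of_norm_eq_left {m : ℕ} {σ ρ : ℝ} (hσ : 0 < σ)
    (hρ : 0 < ρ) (hσρ : σ ≠ ρ) {δ δ' : ℤ} {q : ℂ} (hq : ‖q‖ = σ) (hqS : q ∉ polygon m σ δ) :
    tangentCirclesThrough m σ ρ δ δ' q = ∅ := by
  rw [Set.eq_empty_iff_forall_notMem]
  rintro C ⟨hqC, w, n, hw, -, -, -, rfl⟩
  rw [mem_tangentCircle_iff, hq] at hqC
  have hd : (ρ ^ 2 - σ ^ 2) * σ ≠ 0 := mul_ne_zero (fun h => hσρ (by nlinarith)) hσ.ne'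
  have hc : Real.cos (q.arg - gridAngle m w) = Real.cos 0 := by
    rw [Real.cos_zero]
    apply mul_left_cancel₀ hd
    linear_combination hqC
  obtain ⟨j, hj | hj⟩ := Real.cos_eq_cos_iff.mp hc
  · exact hqS ⟨w, hw, eq_vertex_of_arg (j := -j) hq (by push_cast; linear_combination -hj)⟩
  · exact hqS ⟨w, hw, eq_vertex_of_arg (j := j) hq (by linear_combination hj)⟩

theorem tangentCirclesThrough_eq_empty_of_norm_eq_right {m : ℕ} {σ ρ : ℝ} (hσ : 0 < σ)
    (hρ : 0 < ρ) (hσρ : σ ≠ ρ) {δ δ' : ℤ} {q : ℂ} (hq : ‖q‖ = ρ) (hqS : q ∉ polygon m ρ δ') :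
    tangentCirclesThrough m σ ρ δ δ' q = ∅ := by
  rw [Set.eq_empty_iff_forall_notMem]
  rintro C ⟨hqC, w, n, hw, hn, -, -, rfl⟩
  rw [mem_tangentCircle_iff, hq] at hqC
  have hd : (ρ ^ 2 - σ ^ 2) * ρ ≠ 0 := mul_ne_zero (fun h => hσρ (by nlinarith)) hρ.ne'
  have hc : Real.cos (q.arg - gridAngle m w) = Real.cos (gridAngle m n) := by
    apply mul_left_cancel₀ hd
    linear_combination hqC
  rw [Int.even_iff] at hw hn
  obtain ⟨j, hj | hj⟩ := Real.cos_eq_cos_iff.mp hc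
  · exact hqS ⟨w + n, by rw [Int.even_iff]; omega, eq_vertex_of_arg (j := -j) hq
      (by rw [gridAngle_add]; push_cast; linear_combination -hj)⟩
  · exact hqS ⟨w - n, by rw [Int.even_iff]; omega, eq_vertex_of_arg (j := j) hq
      (by rw [gridAngle_sub]; linear_combination hj)⟩

theorem cos_eq_of_mem_tangentCircle {m : ℕ} {σ ρ : ℝ} (hσ : 0 < σ) (hρ : 0 < ρ) {q : ℂ}
    (hq : ‖q‖ ≠ σ) {w n n' : ℤ} (h : q ∈ tangentCircle m σ ρ w n)
    (h' : q ∈ tangentCircle m σ ρ w n') :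
    Real.cos (gridAngle m n) = Real.cos (gridAngle m n') := by
  rw [mem_tangentCircle_iff] at h h'
  have hd : ρ * (‖q‖ ^ 2 - σ ^ 2) ≠ 0 :=
    mul_ne_zero hρ.ne' (fun h => hq (by nlinarith [norm_nonneg q]))
  apply mul_left_cancel₀ hd
  linear_combination (h' - h)

/-- At most one of the generalised circles is tangent at a given vertex. -/
theorem ncard_tangentCirclesThrough_le {m : ℕ} (hm : 0 < m) {σ ρ : ℝ} (hσ : 0 < σ) (hρ : 0 < ρ)
    {δ δ' : ℤ} {q : ℂ} (hq : ‖q‖ ≠ σ) :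
    (tangentCirclesThrough m σ ρ δ δ' q).Finite ∧
      (tangentCirclesThrough m σ ρ δ δ' q).ncard ≤ m := by
  have hm' : (0 : ℤ) < m := by exact_mod_cast hm
  rw [show (tangentCirclesThrough m σ ρ δ δ' q).ncard ≤ m ↔
    (tangentCirclesThrough m σ ρ δ δ' q).ncard ≤ (Finset.Ico (0 : ℤ) m).card by simp]
  refine ncard_le_card_of_relation
    (fun C j => ∃ n : ℤ, C = tangentCircle m σ ρ (2 * j - δ) n) ?_ ?_
  · rintro C ⟨hqC, w, n, ⟨k, hk⟩, -, -, -, rfl⟩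
    refine ⟨k % m, Finset.mem_Ico.mpr ⟨Int.emod_nonneg _ hm'.ne', Int.emod_lt_of_pos _ hm'⟩, n, ?_⟩
    rw [← tangentCircle_period hm σ ρ (2 * (k % m) - δ) n (k / m)]
    congr 1
    linear_combination hk - 2 * Int.emod_add_mul_ediv k m
  · rintro C ⟨hC, -⟩ C' ⟨hC', -⟩ j - ⟨n, rfl⟩ ⟨n', rfl⟩
    have := cos_eq_of_mem_tangentCircle hσ hρ hq hC hC'
    simp only [tangentCircle, this]

theorem two_mul_card_le_of_parity {J : Finset ℤ} {a b c : ℤ} (hab : a ≤ b + 2)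
    (hJ : ∀ x ∈ J, a ≤ x ∧ x ≤ b ∧ Even (x + c)) : 2 * (J.card : ℤ) ≤ b - a + 2 := by
  have h : J.card ≤ (Finset.Ico (0 : ℤ) ((b - a + 2) / 2)).card := by
    apply Finset.card_le_card_of_injOn (fun x => (x - a) / 2)
    · intro x hx
      obtain ⟨h1, h2, -⟩ := hJ x hx
      simp only [Finset.coe_Ico, Set.mem_Ico]
      omega
    · intro x hx y hy hxy
      obtain ⟨-, -, h1⟩ := hJ x hx
      obtain ⟨-, -, h2⟩ := hJ y hy
      rw [Int.even_iff] at h1 h2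
      simp only at hxy
      omega
  rw [Int.card_Ico] at h
  omega

/-- When `q` lies on no symmetry axis, the tangent circles through `q` are determined by the
angular width of the mirror pair. -/
theorem two_mul_ncard_tangentCirclesThrough_le {m : ℕ} (hm : 0 < m) {σ ρ : ℝ} {δ δ' : ℤ} {q : ℂ}
    {X Y : ℝ} (hcos : ∀ w n : ℤ, q ∈ tangentCircle m σ ρ w n →
      Real.cos (q.arg - gridAngle m w) = X + Y * Real.cos (gridAngle m n))
    (haxis : ∀ e : ℤ, q.arg ≠ gridAngle m e) :
    2 * (tangentCirclesThrough m σ ρ δ δ' q).ncard ≤ m := by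
  have key := ncard_le_card_of_relation (s := tangentCirclesThrough m σ ρ δ δ' q)
    (t := (Finset.Ioo (0 : ℤ) m).filter (fun n => Even (n + δ + δ')))
    (fun C n => ∃ w : ℤ, Even (w + δ) ∧ C = tangentCircle m σ ρ w n) ?_ ?_
  · have h := two_mul_card_le_of_parity (a := 1) (b := m - 1) (c := δ + δ')
      (J := (Finset.Ioo (0 : ℤ) m).filter (fun n => Even (n + δ + δ'))) (by omega) ?_
    · omega
    · intro x hx
      rw [Finset.mem_filter, Finset.mem_Ioo, add_assoc] at hx
      exact ⟨by omega, by omega, hx.2⟩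
  · rintro C ⟨-, w, n, hw, hn, hn0, hnm, rfl⟩
    exact ⟨n, Finset.mem_filter.mpr ⟨Finset.mem_Ioo.mpr ⟨hn0, hnm⟩, hn⟩, w, hw, rfl⟩
  · rintro C ⟨hC, -⟩ C' ⟨hC', -⟩ n - ⟨w, hw, rfl⟩ ⟨w', hw', rfl⟩
    have hc := (hcos w n hC).trans (hcos w' n hC').symm
    obtain ⟨j, hj | hj⟩ := Real.cos_eq_cos_iff.mp hc
    · have : w = w' + 2 * m * j := by
        apply gridAngle_injective hm
        rw [gridAngle_period hm]
        linear_combination hj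
      rw [this, tangentCircle_period hm]
    · exfalso
      obtain ⟨k, hk⟩ := hw.add hw'
      apply haxis (k - δ + m * j)
      have h2 : gridAngle m w + gridAngle m w' = 2 * gridAngle m (k - δ) := by
        rw [← gridAngle_add, two_mul, ← gridAngle_add]
        congr 1
        linear_combination hk
      rw [gridAngle_add, gridAngle_mul_self hm]
      linear_combination hj / 2 + h2 / 2

/-- When `q` lies on a symmetry axis, the tangent circles through `q` come in mirror pairs. -/
theorem ncard_tangentCirclesThrough_le_of_axis {m : ℕ} (hm : 0 < m) {σ ρ : ℝ} (hσ : 0 < σ)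
    (hρ : 0 < ρ) {δ δ' : ℤ} {q : ℂ} (hqσ : ‖q‖ ≠ σ) {X Y : ℝ} (hX : 0 < X) (hY : 0 < Y)
    (hXY : X + Y < 1) (hcos : ∀ w n : ℤ, q ∈ tangentCircle m σ ρ w n →
      Real.cos (q.arg - gridAngle m w) = X + Y * Real.cos (gridAngle m n))
    {e : ℤ} (he : q.arg = gridAngle m e) :
    ∃ J : Finset ℤ, (∀ x ∈ J, 0 < x ∧ x < m ∧ Even (x + (e + δ)) ∧ ∃ n : ℤ, 0 < n ∧ n < m ∧
        Even (n + δ + δ') ∧ Real.cos (gridAngle m x) = X + Y * Real.cos (gridAngle m n)) ∧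
      (tangentCirclesThrough m σ ρ δ δ' q).ncard ≤ 2 * J.card := by
  classical
  refine ⟨(Finset.Ioo (0 : ℤ) m).filter (fun x => Even (x + (e + δ)) ∧ ∃ n : ℤ, 0 < n ∧ n < m ∧
        Even (n + δ + δ') ∧ Real.cos (gridAngle m x) = X + Y * Real.cos (gridAngle m n)), ?_, ?_⟩
  · intro x hx
    rw [Finset.mem_filter, Finset.mem_Ioo] at hx
    exact ⟨hx.1.1, hx.1.2, hx.2⟩
  set J := (Finset.Ioo (0 : ℤ) m).filter (fun x => Even (x + (e + δ)) ∧ ∃ n : ℤ, 0 < n ∧ n < m ∧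
        Even (n + δ + δ') ∧ Real.cos (gridAngle m x) = X + Y * Real.cos (gridAngle m n)) with hJ
  have hcard : (J ×ˢ ({1, -1} : Finset ℤ)).card = 2 * J.card := by
    rw [Finset.card_product, mul_comm]; rfl
  rw [← hcard]
  refine (ncard_le_card_of_relation (fun C (p : ℤ × ℤ) => ∃ n : ℤ,
    C = tangentCircle m σ ρ (e + p.2 * p.1) n) ?_ ?_).2
  · rintro C ⟨hq, w, n, hw, hn, hn0, hnm, rfl⟩
    have hc := hcos w n hq
    have hcw : Real.cos (gridAngle m (w - e)) = X + Y * Real.cos (gridAngle m n) := by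
      rw [← hc, he, ← gridAngle_sub, ← Real.cos_neg, ← gridAngle_neg, neg_sub]
    have hlt : |Real.cos (gridAngle m (w - e))| < 1 := by
      rw [hcw, abs_lt]
      have h1 := Real.cos_le_one (gridAngle m n)
      have h2 := Real.neg_one_le_cos (gridAngle m n)
      constructor <;> nlinarith
    have hndvd : ¬ (m : ℤ) ∣ w - e := by
      rintro ⟨k, hk⟩
      rw [hk, gridAngle_mul_self hm, Real.abs_cos_int_mul_pi] at hlt
      exact lt_irrefl _ hlt
    obtain ⟨x, k, hx0, hxm, hx | hx⟩ := exists_reduced hm hndvd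
    · refine ⟨(x, 1), ?_, n, ?_⟩
      · refine Finset.mem_product.mpr ⟨Finset.mem_filter.mpr ⟨Finset.mem_Ioo.mpr ⟨hx0, hxm⟩,
          ?_, n, hn0, hnm, hn, ?_⟩, by simp⟩
        · rw [show x + (e + δ) = w + δ - 2 * (m * k) by linear_combination -hx]
          exact hw.sub (even_two_mul _)
        · rw [← hcw, hx, cos_gridAngle_period hm]
      · rw [show w = e + 1 * x + 2 * m * k by linear_combination hx, tangentCircle_period hm]
    · refine ⟨(x, -1), ?_, n, ?_⟩
      · refine Finset.mem_product.mpr ⟨Finset.mem_filter.mpr ⟨Finset.mem_Ioo.mpr ⟨hx0, hxm⟩,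
          ?_, n, hn0, hnm, hn, ?_⟩, by simp⟩
        · rw [show x + (e + δ) = 2 * (e + δ + m * k) - (w + δ) by linear_combination hx]
          exact (even_two_mul _).sub hw
        · rw [← hcw, hx, cos_gridAngle_period hm, gridAngle_neg, Real.cos_neg]
      · rw [show w = e + -1 * x + 2 * m * k by linear_combination hx, tangentCircle_period hm]
  · rintro C ⟨hC, -⟩ C' ⟨hC', -⟩ p - ⟨n, rfl⟩ ⟨n', rfl⟩
    have := cos_eq_of_mem_tangentCircle hσ hρ hqσ hC hC'
    simp only [tangentCircle, this]

/-- Two families of grid angles seen from a symmetry axis have at most `m / 2` members in total. -/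
theorem two_mul_card_add_card_le {m : ℕ} {X Y : ℝ} (hX : 0 < X) (hY : 0 < Y) (hXY : X + Y < 1)
    {ε c d : ℤ} (hε : Even (c + d + ε)) {J K : Finset ℤ}
    (hJ : ∀ x ∈ J, 0 < x ∧ x < m ∧ Even (x + c) ∧ ∃ n : ℤ, 0 < n ∧ n < m ∧
      Even (n + ε) ∧ Real.cos (gridAngle m x) = X + Y * Real.cos (gridAngle m n))
    (hK : ∀ x ∈ K, 0 < x ∧ x < m ∧ Even (x + d) ∧ ∃ n : ℤ, 0 < n ∧ n < m ∧
      Even (n + ε) ∧ Real.cos (gridAngle m x) = Y + X * Real.cos (gridAngle m n)) :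
    2 * J.card + 2 * K.card ≤ m := by
  have single : ∀ (L : Finset ℤ) (c : ℤ), (∀ x ∈ L, 0 < x ∧ x < m ∧ Even (x + c)) →
      2 * L.card ≤ m := by
    intro L c hL
    have := two_mul_card_le_of_parity (J := L) (a := 1) (b := m - 1) (c := c) (by omega)
      (fun x hx => ⟨by linarith [(hL x hx).1], by linarith [(hL x hx).2.1], (hL x hx).2.2⟩)
    omega
  rcases J.eq_empty_or_nonempty with rfl | neJ
  · simpa using single K d fun x hx => ⟨(hK x hx).1, (hK x hx).2.1, (hK x hx).2.2.1⟩
  rcases K.eq_empty_or_nonempty with rfl | neK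
  · simpa using single J c fun x hx => ⟨(hJ x hx).1, (hJ x hx).2.1, (hJ x hx).2.2.1⟩
  have cardJ := two_mul_card_le_of_parity (J := J) (a := J.min' neJ) (b := J.max' neJ) (c := c)
    (by linarith [J.min'_le_max' neJ])
    (fun x hx => ⟨J.min'_le x hx, J.le_max' x hx, (hJ x hx).2.2.1⟩)
  have cardK := two_mul_card_le_of_parity (J := K) (a := K.min' neK) (b := K.max' neK) (c := d)
    (by linarith [K.min'_le_max' neK])
    (fun x hx => ⟨K.min'_le x hx, K.le_max' x hx, (hK x hx).2.2.1⟩)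
  obtain ⟨x0, xm, xe, n, n0, nm, ne, hn⟩ := hJ _ (J.min'_mem neJ)
  obtain ⟨y0, ym, ye, k, k0, km, ke, hk⟩ := hK _ (K.min'_mem neK)
  obtain ⟨x0', xm', -, n', n0', nm', -, hn'⟩ := hJ _ (J.max'_mem neJ)
  obtain ⟨y0', ym', -, k', k0', km', -, hk'⟩ := hK _ (K.max'_mem neK)
  set x := J.min' neJ
  set y := K.min' neK
  set x' := J.max' neJ
  set y' := K.max' neK
  have hm : 0 < m := by omega
  have hpi : gridAngle m m = Real.pi := by simpa using gridAngle_mul_self hm 1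
  have hsum : x' + y' < m := by
    by_contra! hle
    have h1 : Real.cos (gridAngle m x') ≤ Real.cos (gridAngle m (m - y')) := by
      rcases hle.eq_or_lt with h | h
      · rw [h, add_sub_cancel_right]
      · exact (cos_gridAngle_lt (by omega) (by omega) (by omega)).le
    rw [gridAngle_sub, hpi, Real.cos_pi_sub] at h1
    have h2 := cos_gridAngle_lt n0'.le nm' le_rfl
    have h3 := cos_gridAngle_lt k0'.le km' le_rfl
    rw [hpi, Real.cos_pi] at h2 h3
    nlinarith
  have hmin : 3 ≤ x + y := by
    by_contra! hlt
    have hx1 : x = 1 := by omega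
    have hy1 : y = 1 := by omega
    rw [Int.even_iff] at *
    have hn2 : 2 ≤ n := by omega
    have hk2 : 2 ≤ k := by omega
    have two : ∀ l : ℤ, 2 ≤ l → l < m →
        Real.cos (gridAngle m l) ≤ 2 * Real.cos (gridAngle m 1) ^ 2 - 1 := by
      intro l h2 hl
      rw [← Real.cos_two_mul, two_mul, ← gridAngle_add]
      rcases h2.eq_or_lt with h | h
      · rw [← h]; norm_num
      · exact (cos_gridAngle_lt (by norm_num) (by omega) hl.le).le
    have h1 := two n hn2 nm
    have h2 := two k hk2 km
    have hpos : 0 < Real.cos (gridAngle m 1) := by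
      have h3 := cos_gridAngle_lt (m := m) (k := 1) (l := m - 1) (by norm_num) (by omega) (by omega)
      rw [gridAngle_sub, hpi, Real.cos_pi_sub] at h3
      linarith
    have hle := Real.cos_le_one (gridAngle m 1)
    rw [hx1] at hn
    rw [hy1] at hk
    set C := Real.cos (gridAngle m 1)
    have h3 : C ≤ (X + Y) * C * C := by nlinarith
    have h4 : 1 ≤ (X + Y) * C := by
      by_contra! h
      nlinarith
    nlinarith
  omega

/-- The bound for points strictly between the two circles. -/
theorem ncard_add_ncard_tangentCirclesThrough_le {m : ℕ} (hm : 0 < m) {r : ℝ} {q : ℂ}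
    (hq1 : 1 < ‖q‖) (hqr : ‖q‖ < r) (δ δ' : ℤ) :
    (tangentCirclesThrough m 1 r δ δ' q).ncard + (tangentCirclesThrough m r 1 δ' δ q).ncard
      ≤ m := by
  have hs : 0 < ‖q‖ := by linarith
  have hr : 0 < r := by linarith
  have hr1 : 0 < r ^ 2 - 1 := by nlinarith
  have hs1 : 0 < ‖q‖ ^ 2 - 1 := by nlinarith
  have hrs : 0 < r ^ 2 - ‖q‖ ^ 2 := by nlinarith
  obtain ⟨X, hXdef⟩ : ∃ X, X = (r ^ 2 - ‖q‖ ^ 2) / (‖q‖ * (r ^ 2 - 1)) := ⟨_, rfl⟩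
  obtain ⟨Y, hYdef⟩ : ∃ Y, Y = r * (‖q‖ ^ 2 - 1) / (‖q‖ * (r ^ 2 - 1)) := ⟨_, rfl⟩
  have hX : 0 < X := by rw [hXdef]; positivity
  have hY : 0 < Y := by rw [hYdef]; positivity
  have hXY : X + Y < 1 := by
    rw [hXdef, hYdef, ← add_div, div_lt_one (by positivity)]
    nlinarith [mul_pos (mul_pos (sub_pos.mpr hq1) (sub_pos.mpr hqr))
      (sub_pos.mpr (hq1.trans hqr))]
  have hA : ∀ w n : ℤ, q ∈ tangentCircle m 1 r w n →
      Real.cos (q.arg - gridAngle m w) = X + Y * Real.cos (gridAngle m n) := by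
    intro w n h
    rw [mem_tangentCircle_iff] at h
    rw [hXdef, hYdef]
    field_simp
    linear_combination h
  have hB : ∀ w n : ℤ, q ∈ tangentCircle m r 1 w n →
      Real.cos (q.arg - gridAngle m w) = Y + X * Real.cos (gridAngle m n) := by
    intro w n h
    rw [mem_tangentCircle_iff] at h
    rw [hXdef, hYdef]
    field_simp
    linear_combination -h
  by_cases haxis : ∃ e : ℤ, q.arg = gridAngle m e
  · obtain ⟨e, he⟩ := haxis
    obtain ⟨J, hJ, cardJ⟩ := ncard_tangentCirclesThrough_le_of_axis (δ := δ) (δ' := δ') hm one_pos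
      hr hq1.ne' hX hY hXY hA he
    obtain ⟨K, hK, cardK⟩ := ncard_tangentCirclesThrough_le_of_axis (δ := δ') (δ' := δ) hm hr
      one_pos hqr.ne hY hX (by linarith) hB he
    have := two_mul_card_add_card_le (m := m) (ε := δ + δ') (c := e + δ) (d := e + δ') hX hY hXY
      ⟨e + δ + δ', by ring⟩ (by simpa only [add_assoc] using hJ)
      (by simpa only [add_assoc, add_comm δ δ'] using hK)
    omega
  · push Not at haxis
    have h1 := two_mul_ncard_tangentCirclesThrough_le (δ := δ) (δ' := δ') hm hA haxis
    have h2 := two_mul_ncard_tangentCirclesThrough_le (δ := δ') (δ' := δ) hm hB haxis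
    omega

theorem tangentCirclesThrough_eq_empty_of_lt_norm {m : ℕ} {r : ℝ} (hr : 1 < r) {q : ℂ}
    (hq : r < ‖q‖) (δ δ' : ℤ) : tangentCirclesThrough m r 1 δ δ' q = ∅ := by
  rw [Set.eq_empty_iff_forall_notMem]
  rintro C ⟨hqC, w, n, -, -, -, -, rfl⟩
  rw [mem_tangentCircle_iff] at hqC
  have h1 := Real.cos_le_one (q.arg - gridAngle m w)
  have h2 := Real.cos_le_one (gridAngle m n)
  have h3 : 0 < r ^ 2 - 1 := by nlinarith
  have h4 : 0 < ‖q‖ ^ 2 - r ^ 2 := by nlinarith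
  have h5 : 0 < ‖q‖ := by linarith
  nlinarith [mul_pos (mul_pos (sub_pos.mpr hq) (sub_pos.mpr (hr.trans hq))) (sub_pos.mpr hr),
    mul_nonneg (mul_pos h3 h5).le (sub_nonneg.mpr h1), mul_nonneg h4.le (sub_nonneg.mpr h2)]

theorem tangentCirclesThrough_eq_empty_of_norm_lt {m : ℕ} {r : ℝ} (hr : 1 < r) {q : ℂ}
    (hq : ‖q‖ < 1) (δ δ' : ℤ) : tangentCirclesThrough m 1 r δ δ' q = ∅ := by
  rw [Set.eq_empty_iff_forall_notMem]
  rintro C ⟨hqC, w, n, -, -, -, -, rfl⟩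
  rw [mem_tangentCircle_iff] at hqC
  have h1 := Real.cos_le_one (q.arg - gridAngle m w)
  have h2 := Real.cos_le_one (gridAngle m n)
  have h3 : 0 < r ^ 2 - 1 := by nlinarith
  have h5 := norm_nonneg q
  have h4 : 0 < r * (1 - ‖q‖ ^ 2) := mul_pos (by linarith) (by nlinarith)
  nlinarith [mul_pos (mul_pos (sub_pos.mpr hq) (sub_pos.mpr (hq.trans hr))) (sub_pos.mpr hr),
    mul_nonneg (mul_nonneg h3.le h5) (sub_nonneg.mpr h1), mul_nonneg h4.le (sub_nonneg.mpr h2)]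

theorem mem_polygon_iff {m : ℕ} (hm : 0 < m) (σ : ℝ) (δ : ℤ) (z : ℂ) :
    z ∈ polygon m σ δ ↔ ∃ k : ℕ, k < m ∧ z = vertex m σ (2 * k + δ) := by
  have hm' : (0 : ℤ) < m := by exact_mod_cast hm
  constructor
  · rintro ⟨k, ⟨l, hl⟩, rfl⟩
    have h0 := Int.emod_nonneg (l - δ) hm'.ne'
    have h1 := Int.emod_lt_of_pos (l - δ) hm'
    refine ⟨((l - δ) % m).toNat, by omega, ?_⟩
    rw [Int.toNat_of_nonneg h0, ← vertex_period hm σ (2 * ((l - δ) % m) + δ) ((l - δ) / m)]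
    congr 1
    linear_combination hl - 2 * Int.emod_add_mul_ediv (l - δ) m
  · rintro ⟨k, -, rfl⟩
    exact ⟨2 * k + δ, ⟨k + δ, by ring⟩, rfl⟩

theorem alignedDoublePolygon_eq {m : ℕ} (hm : 0 < m) (r : ℝ) :
    alignedDoublePolygon m r = polygon m 1 0 ∪ polygon m r 0 := by
  ext z
  simp only [alignedDoublePolygon, Set.mem_union, Set.mem_ofPred_eq, mem_polygon_iff hm, vertex,
    gridAngle, Complex.ofReal_one, one_mul, add_zero, Int.cast_mul, Int.cast_ofNat,
    Int.cast_natCast]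
  simp only [← mul_assoc, mul_comm Real.pi 2]

theorem offsetDoublePolygon_eq {m : ℕ} (hm : 0 < m) (r : ℝ) :
    offsetDoublePolygon m r = polygon m 1 0 ∪ polygon m r 1 := by
  ext z
  simp only [offsetDoublePolygon, Set.mem_union, Set.mem_ofPred_eq, mem_polygon_iff hm, vertex,
    gridAngle, Complex.ofReal_one, one_mul, add_zero, Int.cast_mul, Int.cast_ofNat,
    Int.cast_natCast, Int.cast_add, Int.cast_one]
  simp only [← mul_assoc, mul_comm Real.pi 2]

theorem ncard_ordinary_through_le {m : ℕ} (hm : 0 < m) {r : ℝ} (hr : 1 < r) {δ δ' : ℤ} {q : ℂ}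
    (hq : q ∉ polygon m 1 δ ∪ polygon m r δ') :
    {C : Set ℂ | IsGenCircle C ∧ (C ∩ (polygon m 1 δ ∪ polygon m r δ')).ncard = 3 ∧
      q ∈ C}.ncard ≤ m := by
  have hr0 : 0 < r := by linarith
  rw [Set.mem_union, not_or] at hq
  have hclass : ∀ C : Set ℂ, (IsGenCircle C ∧
      (C ∩ (polygon m 1 δ ∪ polygon m r δ')).ncard = 3 ∧ q ∈ C) →
      (C = Metric.sphere 0 ‖q‖ ∧ (‖q‖ = 1 ∨ ‖q‖ = r)) ∨
      C ∈ tangentCirclesThrough m 1 r δ δ' q ∨ C ∈ tangentCirclesThrough m r 1 δ' δ q := by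
    rintro C ⟨hC, h3, hqC⟩
    rcases ordinary_classification hm one_pos hr0 hr.ne hC hqC h3 with h | h | h
    · rw [h, mem_sphere_zero_iff_norm] at hqC
      exact Or.inl ⟨by rw [h, hqC], Or.inl hqC⟩
    · rw [h, mem_sphere_zero_iff_norm] at hqC
      exact Or.inl ⟨by rw [h, hqC], Or.inr hqC⟩
    · exact Or.inr h
  by_cases hsphere : ‖q‖ = 1 ∨ ‖q‖ = r
  · have hempty : tangentCirclesThrough m 1 r δ δ' q = ∅ ∧
        tangentCirclesThrough m r 1 δ' δ q = ∅ := by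
      rcases hsphere with h | h
      · exact ⟨tangentCirclesThrough_eq_empty_of_norm_eq_left one_pos hr0 hr.ne h hq.1,
          tangentCirclesThrough_eq_empty_of_norm_eq_right hr0 one_pos hr.ne' h hq.1⟩
      · exact ⟨tangentCirclesThrough_eq_empty_of_norm_eq_right one_pos hr0 hr.ne h hq.2,
          tangentCirclesThrough_eq_empty_of_norm_eq_left hr0 one_pos hr.ne' h hq.2⟩
    rw [hempty.1, hempty.2] at hclass
    refine (Set.ncard_le_ncard (t := {Metric.sphere 0 ‖q‖}) (fun C hC => ?_)).trans ?_
    · simpa using ((hclass C hC).resolve_right (by simp)).1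
    · rw [Set.ncard_singleton]
      exact hm
  · have hsub : {C : Set ℂ | IsGenCircle C ∧
        (C ∩ (polygon m 1 δ ∪ polygon m r δ')).ncard = 3 ∧ q ∈ C} ⊆
        tangentCirclesThrough m 1 r δ δ' q ∪ tangentCirclesThrough m r 1 δ' δ q :=
      fun C hC => (hclass C hC).resolve_left fun h => hsphere h.2
    rw [not_or] at hsphere
    have hA := ncard_tangentCirclesThrough_le (δ := δ) (δ' := δ') hm one_pos hr0 hsphere.1
    have hB := ncard_tangentCirclesThrough_le (δ := δ') (δ' := δ) hm hr0 one_pos hsphere.2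
    refine (Set.ncard_le_ncard hsub (hA.1.union hB.1)).trans ?_
    rcases lt_or_gt_of_ne hsphere.1 with h1 | h1
    · rw [tangentCirclesThrough_eq_empty_of_norm_lt hr h1, Set.empty_union]
      exact hB.2
    rcases lt_or_gt_of_ne hsphere.2 with h2 | h2
    · exact (Set.ncard_union_le _ _).trans
        (ncard_add_ncard_tangentCirclesThrough_le hm h1 h2 δ δ')
    · rw [tangentCirclesThrough_eq_empty_of_lt_norm hr h2, Set.union_empty]
      exact hA.2

/-- Every point not in an aligned or offset double `m`-gon `S` lies on at most `m`
ordinary generalised circles determined by `S`. -/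
theorem double_polygon_ordinary_through_point
    (m : ℕ) (hm : 2 ≤ m) (r : ℝ) (hr : 1 < r) (S : Set ℂ)
    (hS : S = alignedDoublePolygon m r ∨ S = offsetDoublePolygon m r)
    (q : ℂ) (hq : q ∉ S) :
    ({C : Set ℂ | IsGenCircle C ∧ (C ∩ S).ncard = 3 ∧ q ∈ C}).ncard ≤ m := by
  have hm0 : 0 < m := by omega
  rcases hS with rfl | rfl
  · rw [alignedDoublePolygon_eq hm0] at hq ⊢
    exact ncard_ordinary_through_le hm0 hr hq
  · rw [offsetDoublePolygon_eq hm0] at hq ⊢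
    exact ncard_ordinary_through_le hm0 hr hq
end
end

section
/- For every positive integer n, the number of quadruples (k₁, k₂, k₃, k₄) ∈ (ℤ/nℤ)⁴ with k₁, k₂, k₃, k₄ pairwise distinct and k₁ + k₂ + k₃ + k₄ = 0 equals n³ − 6n² + (8 + 3δₙ)n − 6εₙ, where δₙ is the number of elements k ∈ ℤ/nℤ with 2k = 0 and εₙ is the number of elements k ∈ ℤ/nℤ with 4k = 0. -/
/-- Möbius inversion on the partition lattice of a four-element set. -/
theorem ite_pairwise_distinct_eq {α : Type*} [DecidableEq α] (a b c d : α) :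
    (if a ≠ b ∧ a ≠ c ∧ a ≠ d ∧ b ≠ c ∧ b ≠ d ∧ c ≠ d then (1 : ℤ) else 0) =
      1 - ((if a = b then 1 else 0) + (if a = c then 1 else 0) + (if a = d then 1 else 0) +
        (if b = c then 1 else 0) + (if b = d then 1 else 0) + (if c = d then 1 else 0)) +
      ((if a = b then if c = d then 1 else 0 else 0) +
        (if a = c then if b = d then 1 else 0 else 0) +
        (if b = c then if a = d then 1 else 0 else 0)) +
      2 * ((if a = b then if b = c then 1 else 0 else 0) +
        (if a = b then if b = d then 1 else 0 else 0) +
        (if a = c then if c = d then 1 else 0 else 0) +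
        (if b = c then if c = d then 1 else 0 else 0)) -
      6 * (if a = b then if b = c then if c = d then 1 else 0 else 0 else 0) := by
  grind

section

variable {G : Type*} [AddCommGroup G] [Fintype G] [DecidableEq G]

theorem sum_sum_ite_two_nsmul_add :
    ∑ x : G, ∑ y : G, (if 2 • (x + y) = 0 then (1 : ℤ) else 0) =
      Fintype.card G * ∑ x : G, (if 2 • x = 0 then (1 : ℤ) else 0) := by
  rw [← Finset.card_univ, ← nsmul_eq_mul, ← Finset.sum_const]
  exact Finset.sum_congr rfl fun x _ =>
    Equiv.sum_comp (Equiv.addLeft x) fun z => if 2 • z = 0 then (1 : ℤ) else 0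

theorem sum_ite_pairwise_distinct_sum_zero :
    ∑ a : G, ∑ b : G, ∑ c : G,
      (if a ≠ b ∧ a ≠ c ∧ a ≠ -(a + b + c) ∧ b ≠ c ∧ b ≠ -(a + b + c) ∧ c ≠ -(a + b + c)
        then (1 : ℤ) else 0) =
      (Fintype.card G : ℤ) ^ 3 - 6 * (Fintype.card G : ℤ) ^ 2 +
        (8 + 3 * ∑ x : G, (if 2 • x = 0 then (1 : ℤ) else 0)) * Fintype.card G -
        6 * ∑ x : G, (if 4 • x = 0 then (1 : ℤ) else 0) := by
  have h_ad : ∀ a b c : G, a = -(a + b + c) ↔ c = -(2 • a + b) := fun a b c => by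
    rw [eq_neg_iff_add_eq_zero, eq_neg_iff_add_eq_zero]
    exact Eq.congr_left (by abel)
  have h_bd : ∀ a b c : G, b = -(a + b + c) ↔ c = -(a + 2 • b) := fun a b c => by
    rw [eq_neg_iff_add_eq_zero, eq_neg_iff_add_eq_zero]
    exact Eq.congr_left (by abel)
  have h_cd : ∀ a b c : G, c = -(a + b + c) ↔ b = -(a + 2 • c) := fun a b c => by
    rw [eq_neg_iff_add_eq_zero, eq_neg_iff_add_eq_zero]
    exact Eq.congr_left (by abel)
  have s_cd : ∑ a : G, ∑ b : G, ∑ c : G, (if c = -(a + b + c) then (1 : ℤ) else 0) =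
      (Fintype.card G : ℤ) ^ 2 := by
    simp_rw [h_cd]
    rw [Finset.sum_congr rfl fun a _ => Finset.sum_comm]
    simp [sq]
  have s_ab_cd : ∑ a : G, ∑ b : G, ∑ c : G,
      (if a = b then if c = -(a + b + c) then (1 : ℤ) else 0 else 0) =
      Fintype.card G * ∑ x : G, (if 2 • x = 0 then (1 : ℤ) else 0) := by
    rw [← sum_sum_ite_two_nsmul_add]
    refine Finset.sum_congr rfl fun a _ => ?_
    rw [Finset.sum_comm]
    refine Finset.sum_congr rfl fun c _ => ?_
    rw [Finset.sum_ite_eq, if_pos (Finset.mem_univ _)]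
    simp only [eq_neg_iff_add_eq_zero]
    exact if_congr (Eq.congr_left (by abel)) rfl rfl
  have s_ac_bd : ∑ a : G, ∑ b : G, ∑ c : G,
      (if a = c then if b = -(a + b + c) then (1 : ℤ) else 0 else 0) =
      Fintype.card G * ∑ x : G, (if 2 • x = 0 then (1 : ℤ) else 0) := by
    rw [← sum_sum_ite_two_nsmul_add]
    refine Finset.sum_congr rfl fun a _ => Finset.sum_congr rfl fun c _ => ?_
    rw [Finset.sum_ite_eq, if_pos (Finset.mem_univ _)]
    simp only [eq_neg_iff_add_eq_zero]
    exact if_congr (Eq.congr_left (by abel)) rfl rfl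
  have s_bc_ad : ∑ a : G, ∑ b : G, ∑ c : G,
      (if b = c then if a = -(a + b + c) then (1 : ℤ) else 0 else 0) =
      Fintype.card G * ∑ x : G, (if 2 • x = 0 then (1 : ℤ) else 0) := by
    rw [← sum_sum_ite_two_nsmul_add]
    refine Finset.sum_congr rfl fun a _ => Finset.sum_congr rfl fun c _ => ?_
    rw [Finset.sum_ite_eq, if_pos (Finset.mem_univ _)]
    simp only [eq_neg_iff_add_eq_zero]
    exact if_congr (Eq.congr_left (by abel)) rfl rfl
  have s_abd : ∑ a : G, ∑ b : G, ∑ c : G,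
      (if a = b then if b = -(a + b + c) then (1 : ℤ) else 0 else 0) = Fintype.card G := by
    rw [Finset.sum_congr rfl fun a _ => Finset.sum_comm]
    simp [-neg_add_rev, h_bd]
  have s_acd : ∑ a : G, ∑ b : G, ∑ c : G,
      (if a = c then if c = -(a + b + c) then (1 : ℤ) else 0 else 0) = Fintype.card G := by
    simp [-neg_add_rev, h_cd]
  have s_bcd : ∑ a : G, ∑ b : G, ∑ c : G,
      (if b = c then if c = -(a + b + c) then (1 : ℤ) else 0 else 0) = Fintype.card G := by
    have h : ∀ a b : G, b = -(a + b + b) ↔ a = -(3 • b) := fun a b => by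
      rw [eq_neg_iff_add_eq_zero, eq_neg_iff_add_eq_zero]
      exact Eq.congr_left (by abel)
    rw [Finset.sum_comm]
    simp [-neg_add_rev, h]
  have s_abc : ∑ a : G, ∑ b : G, ∑ c : G,
      (if a = b then if b = c then (1 : ℤ) else 0 else 0) = Fintype.card G := by
    simp
  have s_abcd : ∑ a : G, ∑ b : G, ∑ c : G,
      (if a = b then if b = c then if c = -(a + b + c) then (1 : ℤ) else 0 else 0 else 0) =
      ∑ x : G, (if 4 • x = 0 then (1 : ℤ) else 0) := by
    refine Finset.sum_congr rfl fun a _ => ?_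
    rw [Finset.sum_comm]
    simp only [Finset.sum_ite_eq, Finset.mem_univ, if_true, eq_neg_iff_add_eq_zero]
    exact if_congr (Eq.congr_left (by abel)) rfl rfl
  have s_ab : ∑ a : G, ∑ b : G, ∑ _c : G, (if a = b then (1 : ℤ) else 0) =
      (Fintype.card G : ℤ) ^ 2 := by
    simp [sq]
  have s_ac : ∑ a : G, ∑ _b : G, ∑ c : G, (if a = c then (1 : ℤ) else 0) =
      (Fintype.card G : ℤ) ^ 2 := by
    simp [sq]
  have s_bc : ∑ _a : G, ∑ b : G, ∑ c : G, (if b = c then (1 : ℤ) else 0) =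
      (Fintype.card G : ℤ) ^ 2 := by
    simp [sq]
  have s_ad : ∑ a : G, ∑ b : G, ∑ c : G, (if a = -(a + b + c) then (1 : ℤ) else 0) =
      (Fintype.card G : ℤ) ^ 2 := by
    simp [-neg_add_rev, h_ad, sq]
  have s_bd : ∑ a : G, ∑ b : G, ∑ c : G, (if b = -(a + b + c) then (1 : ℤ) else 0) =
      (Fintype.card G : ℤ) ^ 2 := by
    simp [-neg_add_rev, h_bd, sq]
  have s_one : ∑ _a : G, ∑ _b : G, ∑ _c : G, (1 : ℤ) = (Fintype.card G : ℤ) ^ 3 := by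
    simp [pow_succ, mul_assoc]
  simp only [ite_pairwise_distinct_eq, Finset.sum_add_distrib, Finset.sum_sub_distrib,
    ← Finset.mul_sum, s_one, s_ab, s_ac, s_ad, s_bc, s_bd, s_cd, s_ab_cd, s_ac_bd, s_bc_ad,
    s_abc, s_abd, s_acd, s_bcd, s_abcd]
  ring

theorem ncard_setOf_eq_sum_ite {α : Type*} [Fintype α] (p : α → Prop) [DecidablePred p] :
    ({x | p x}.ncard : ℤ) = ∑ x, if p x then (1 : ℤ) else 0 := by
  rw [Finset.sum_boole, ← Set.ncard_coe_finset, Finset.coe_filter_univ]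

end

/-- The number of quadruples of pairwise distinct elements of `ℤ/nℤ` summing to zero
equals `n³ − 6n² + (8 + 3δₙ)n − 6εₙ`, where `δₙ = #{k : 2k = 0}` and
`εₙ = #{k : 4k = 0}`. -/
theorem count_distinct_quadruples_sum_zero (n : ℕ) (hn : 0 < n) :
    (({t : ZMod n × ZMod n × ZMod n × ZMod n |
        t.1 + t.2.1 + t.2.2.1 + t.2.2.2 = 0 ∧
        t.1 ≠ t.2.1 ∧ t.1 ≠ t.2.2.1 ∧ t.1 ≠ t.2.2.2 ∧
        t.2.1 ≠ t.2.2.1 ∧ t.2.1 ≠ t.2.2.2 ∧ t.2.2.1 ≠ t.2.2.2}).ncard : ℤ) =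
      (n : ℤ) ^ 3 - 6 * (n : ℤ) ^ 2 +
        (8 + 3 * ({k : ZMod n | 2 * k = 0}.ncard : ℤ)) * (n : ℤ) -
        6 * ({k : ZMod n | 4 * k = 0}.ncard : ℤ) := by
  have : NeZero n := ⟨hn.ne'⟩
  have h := sum_ite_pairwise_distinct_sum_zero (G := ZMod n)
  simp only [ZMod.card, nsmul_eq_mul, Nat.cast_ofNat] at h
  rw [ncard_setOf_eq_sum_ite, ncard_setOf_eq_sum_ite, ncard_setOf_eq_sum_ite, ← h]
  simp only [Fintype.sum_prod_type]
  refine Finset.sum_congr rfl fun a _ => Finset.sum_congr rfl fun b _ =>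
    Finset.sum_congr rfl fun c _ => ?_
  have hd : ∀ d : ZMod n, a + b + c + d = 0 ↔ -(a + b + c) = d := fun d =>
    neg_eq_iff_add_eq_zero.symm
  simp only [hd, ite_and _ (_ ∧ _)]
  rw [Finset.sum_ite_eq, if_pos (Finset.mem_univ _)]
end

section
/- Let m ≥ 4 be an integer and r > 1 a real number, and let S be the aligned double m-gon with radii 1 and r, that is, S = {e^{2πik/m} : 0 ≤ k < m} ∪ {r·e^{2πik/m} : 0 ≤ k < m} ⊂ ℂ ≅ ℝ². Then the number of ordinary generalised circles determined by S equals m(m−2) if m is even and m(m−1) if m is odd. -/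
noncomputable section

open ComplexConjugate in
lemma Complex.eq_or_eq_conj_of_normSq_eq_of_re_eq {a b : ℂ}
    (hn : Complex.normSq a = Complex.normSq b) (hre : a.re = b.re) : a = b ∨ a = conj b := by
  rw [Complex.normSq_apply, Complex.normSq_apply, hre] at hn
  rcases mul_self_eq_mul_self_iff.mp (add_left_cancel hn) with h | h
  · exact Or.inl (Complex.ext hre h)
  · exact Or.inr (Complex.ext (by simpa using hre) (by simpa using h))

open ComplexConjugate in
lemma Complex.mul_conj_eq_one_of_normSq_eq_one {u : ℂ} (hu : Complex.normSq u = 1) :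
    u * conj u = 1 := by
  rw [Complex.mul_conj, hu, Complex.ofReal_one]

open ComplexConjugate in
/-- A generalised circle is the zero set of a quadratic equation. -/
lemma IsGenCircle.exists_equation_s18 {K : Set ℂ} (hK : IsGenCircle K) :
    ∃ (A : ℝ) (B : ℂ) (D : ℝ),
      K = {z | A * Complex.normSq z + (z * conj B).re + D = 0} := by
  rcases hK with ⟨c, ρ, hρ, rfl⟩ | ⟨a, d, hd, rfl⟩
  · refine ⟨1, -2 * c, Complex.normSq c - ρ ^ 2, ?_⟩
    ext z
    have h : z ∈ Metric.sphere c ρ ↔ Complex.normSq (z - c) = ρ ^ 2 := by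
      rw [mem_sphere_iff_norm, Complex.normSq_eq_norm_sq,
        sq_eq_sq₀ (norm_nonneg _) hρ.le]
    rw [h, Set.mem_ofPred_eq]
    simp only [Complex.normSq_apply, Complex.sub_re, Complex.sub_im, Complex.mul_re,
      Complex.conj_re, Complex.conj_im, Complex.mul_im, Complex.neg_re, Complex.neg_im,
      Complex.re_ofNat, Complex.im_ofNat]
    constructor <;> intro h <;> linarith
  · refine ⟨0, Complex.I * d, -(a * conj (Complex.I * d)).re, ?_⟩
    ext z
    have hd' : d.re ^ 2 + d.im ^ 2 ≠ 0 := by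
      rw [pow_two, pow_two, ← Complex.normSq_apply]
      exact (Complex.normSq_pos.mpr hd).ne'
    simp only [Set.mem_ofPred_eq, Complex.mul_re, Complex.conj_re, Complex.conj_im,
      Complex.mul_im, Complex.I_re, Complex.I_im]
    constructor
    · rintro ⟨t, rfl⟩
      simp
      ring
    · intro h
      refine ⟨((z.re - a.re) * d.re + (z.im - a.im) * d.im) /
        (d.re ^ 2 + d.im ^ 2), ?_⟩
      apply Complex.ext
      · simp only [Complex.real_smul, Complex.add_re, Complex.mul_re, Complex.ofReal_re,
          Complex.ofReal_im]
        field_simp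
        linear_combination (-d.im) * h
      · simp only [Complex.real_smul, Complex.add_im, Complex.mul_im, Complex.ofReal_re,
          Complex.ofReal_im]
        field_simp
        linear_combination d.re * h

open ComplexConjugate in
/-- The generalised circle tangent to the circle `|z| = p` at `p * u` and meeting the circle
`|z| = q` in `q * u * v` and its mirror image, for unit complex numbers `u`, `v`. -/
def tangentGenCircle (p q : ℝ) (u v : ℂ) : Set ℂ :=
  {z | (p - q * v.re) * (Complex.normSq z - p ^ 2) =
    (p ^ 2 - q ^ 2) * ((z * conj u).re - p)}

section tangentGenCircle

variable {p q : ℝ} {u v w : ℂ}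

open ComplexConjugate in
lemma mul_mem_tangentGenCircle_self_iff (hp : 0 < p) (hpq : p ^ 2 ≠ q ^ 2)
    (hu : Complex.normSq u = 1) (hw : Complex.normSq w = 1) :
    (p : ℂ) * w ∈ tangentGenCircle p q u v ↔ w = u := by
  have huu := Complex.mul_conj_eq_one_of_normSq_eq_one hu
  simp only [tangentGenCircle, Set.mem_ofPred_eq, Complex.normSq_mul, Complex.normSq_ofReal, hw,
    mul_assoc, Complex.re_ofReal_mul]
  constructor
  · intro h
    have h1 : (p ^ 2 - q ^ 2) * p * ((w * conj u).re - 1) = 0 := by linear_combination -h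
    have h2 : (w * conj u).re = (1 : ℂ).re := by
      rw [Complex.one_re]
      have := (mul_eq_zero.mp h1).resolve_left (mul_ne_zero (sub_ne_zero.mpr hpq) hp.ne')
      linarith
    have h3 : w * conj u = 1 := by
      have := Complex.eq_or_eq_conj_of_normSq_eq_of_re_eq
        (by rw [Complex.normSq_mul, Complex.normSq_conj, hw, hu]; simp) h2
      simpa using this
    linear_combination u * h3 - w * huu
  · rintro rfl
    rw [huu, Complex.one_re]
    ring

open ComplexConjugate in
lemma mul_mem_tangentGenCircle_iff (hq : 0 < q) (hpq : p ^ 2 ≠ q ^ 2)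
    (hu : Complex.normSq u = 1) (hv : Complex.normSq v = 1) (hw : Complex.normSq w = 1) :
    (q : ℂ) * w ∈ tangentGenCircle p q u v ↔ w = u * v ∨ w = u * conj v := by
  have huu := Complex.mul_conj_eq_one_of_normSq_eq_one hu
  simp only [tangentGenCircle, Set.mem_ofPred_eq, Complex.normSq_mul, Complex.normSq_ofReal, hw,
    mul_assoc, Complex.re_ofReal_mul]
  have key : (p - q * v.re) * (q * (q * 1) - p ^ 2) =
      (p ^ 2 - q ^ 2) * (q * (w * conj u).re - p) ↔ (w * conj u).re = v.re := by
    constructor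
    · intro h
      have h1 : (p ^ 2 - q ^ 2) * q * ((w * conj u).re - v.re) = 0 := by linear_combination -h
      have := (mul_eq_zero.mp h1).resolve_left (mul_ne_zero (sub_ne_zero.mpr hpq) hq.ne')
      linarith
    · intro h
      rw [h]
      ring
  rw [key]
  constructor
  · intro h
    rcases Complex.eq_or_eq_conj_of_normSq_eq_of_re_eq
      (by rw [Complex.normSq_mul, Complex.normSq_conj, hw, hu, hv, one_mul]) h with h | h
    · left
      linear_combination u * h - w * huu
    · right
      linear_combination u * h - w * huu
  · rintro (rfl | rfl)
    · rw [mul_right_comm, huu, one_mul]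
    · rw [mul_right_comm, huu, one_mul, Complex.conj_re]

open ComplexConjugate in
lemma isGenCircle_tangentGenCircle (hp : 0 < p) (hpq : p ^ 2 ≠ q ^ 2)
    (hu : Complex.normSq u = 1) (hv : v.re ^ 2 < 1) :
    IsGenCircle (tangentGenCircle p q u v) := by
  have hu' := hu
  rw [Complex.normSq_apply] at hu'
  have hb : p ^ 2 - q ^ 2 ≠ 0 := sub_ne_zero.mpr hpq
  by_cases hA : p - q * v.re = 0
  · right
    refine ⟨p * u, Complex.I * u, ?_, ?_⟩
    · refine mul_ne_zero Complex.I_ne_zero ?_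
      rintro rfl
      simp at hu
    · ext z
      simp only [tangentGenCircle, Set.mem_ofPred_eq, hA, zero_mul, zero_eq_mul, hb, false_or,
        Complex.mul_re, Complex.conj_re, Complex.conj_im]
      constructor
      · intro h
        refine ⟨z.im * u.re - z.re * u.im, Complex.ext ?_ ?_⟩
        · simp
          linear_combination u.re * h - z.re * hu'
        · simp
          linear_combination u.im * h - z.im * hu'
      · rintro ⟨t, rfl⟩
        simp
        linear_combination p * hu'
  · left
    have hpos : 0 < p ^ 2 - 2 * p * q * v.re + q ^ 2 := by
      have h1 : p ^ 2 - 2 * p * q * v.re + q ^ 2 =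
        (q - p * v.re) ^ 2 + p ^ 2 * (1 - v.re ^ 2) := by ring
      rw [h1]
      have := mul_pos (pow_pos hp 2) (sub_pos.mpr hv)
      positivity
    refine ⟨((p ^ 2 - q ^ 2) / (2 * (p - q * v.re)) : ℝ) * u,
      (p ^ 2 - 2 * p * q * v.re + q ^ 2) / (2 * |p - q * v.re|), by positivity, ?_⟩
    ext z
    rw [mem_sphere_iff_norm, ← sq_eq_sq₀ (norm_nonneg _) (by positivity),
      ← Complex.normSq_eq_norm_sq, div_pow, mul_pow, sq_abs]
    simp only [tangentGenCircle, Set.mem_ofPred_eq]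
    simp only [Complex.normSq_apply, Complex.sub_re, Complex.sub_im, Complex.mul_re,
      Complex.mul_im, Complex.conj_re, Complex.conj_im, Complex.ofReal_re, Complex.ofReal_im]
    generalize hAdef : p - q * v.re = A at *
    have hN : p ^ 2 - 2 * p * q * v.re + q ^ 2 = 2 * p * A - (p ^ 2 - q ^ 2) := by
      rw [← hAdef]; ring
    rw [hN]
    generalize p ^ 2 - q ^ 2 = b at *
    field_simp
    constructor
    · intro h
      linear_combination 4 * A * h + b ^ 2 * hu'
    · intro h
      have : 4 * A * (A * (z.re * z.re + z.im * z.im - p ^ 2) -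
          b * (z.re * u.re - z.im * -u.im - p)) = 0 := by
        linear_combination h - b ^ 2 * hu'
      have := (mul_eq_zero.mp this).resolve_left (by positivity)
      linarith

end tangentGenCircle

/-- The two radii of a double polygon. -/
def doublePolygonRadius (r : ℝ) (b : Bool) : ℝ := cond b r 1

section doublePolygonRadius

variable {r : ℝ}

lemma doublePolygonRadius_pos (hr : 1 < r) (b : Bool) : 0 < doublePolygonRadius r b := by
  cases b <;> simp only [doublePolygonRadius, cond_true, cond_false] <;> linarith

lemma doublePolygonRadius_injective (hr : 1 < r) :
    Function.Injective (doublePolygonRadius r) := by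
  intro a b h
  cases a <;> cases b <;> simp [doublePolygonRadius] at h ⊢ <;> linarith

lemma doublePolygonRadius_sq_ne (hr : 1 < r) (b : Bool) :
    doublePolygonRadius r b ^ 2 ≠ doublePolygonRadius r (!b) ^ 2 := by
  intro h
  rw [sq_eq_sq₀ (doublePolygonRadius_pos hr _).le (doublePolygonRadius_pos hr _).le] at h
  simpa using doublePolygonRadius_injective hr h

lemma doublePolygonRadius_mul_inj (hr : 1 < r) {a b : Bool} {w x : ℂ}
    (hw : Complex.normSq w = 1) (hx : Complex.normSq x = 1) :
    (doublePolygonRadius r a : ℂ) * w = doublePolygonRadius r b * x ↔ a = b ∧ w = x := by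
  constructor
  · intro h
    have h1 := congrArg Complex.normSq h
    rw [Complex.normSq_mul, Complex.normSq_mul, hw, hx, Complex.normSq_ofReal,
      Complex.normSq_ofReal, mul_one, mul_one] at h1
    have hab := doublePolygonRadius_injective hr
      ((mul_self_inj (doublePolygonRadius_pos hr _).le (doublePolygonRadius_pos hr _).le).mp h1)
    subst hab
    exact ⟨rfl, mul_left_cancel₀
      (Complex.ofReal_ne_zero.mpr (doublePolygonRadius_pos hr a).ne') h⟩
  · rintro ⟨rfl, rfl⟩
    rfl

end doublePolygonRadius

lemma Complex.normSq_eq_one_of_pow_eq_one {m : ℕ} (hm : m ≠ 0) {w : ℂ} (hw : w ^ m = 1) :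
    Complex.normSq w = 1 := by
  rw [Complex.normSq_eq_norm_sq, Complex.norm_eq_one_of_pow_eq_one hw hm, one_pow]

lemma mem_alignedDoublePolygon {m : ℕ} (hm : m ≠ 0) {r : ℝ} {z : ℂ} :
    z ∈ alignedDoublePolygon m r ↔
      ∃ (b : Bool) (w : ℂ), w ^ m = 1 ∧ z = doublePolygonRadius r b * w := by
  have hroot (w : ℂ) : w ^ m = 1 ↔ ∃ k : ℕ, k < m ∧
      w = Complex.exp (((2 * Real.pi * (k : ℝ) / (m : ℝ) : ℝ) : ℂ) * Complex.I) := by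
    have hexp (k : ℕ) : Complex.exp (((2 * Real.pi * (k : ℝ) / (m : ℝ) : ℝ) : ℂ) * Complex.I) =
        Complex.exp (2 * Real.pi * Complex.I / m) ^ k := by
      rw [← Complex.exp_nat_mul]
      congr 1
      push_cast
      ring
    have hζ := Complex.isPrimitiveRoot_exp m hm
    have : NeZero m := ⟨hm⟩
    constructor
    · intro h
      obtain ⟨k, hk, rfl⟩ := hζ.eq_pow_of_pow_eq_one h
      exact ⟨k, hk, (hexp k).symm⟩
    · rintro ⟨k, -, rfl⟩
      rw [hexp, pow_right_comm, hζ.pow_eq_one, one_pow]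
  simp only [alignedDoublePolygon, Set.mem_union, Set.mem_ofPred_eq, Bool.exists_bool, hroot,
    doublePolygonRadius, cond_false, cond_true, Complex.ofReal_one, one_mul]
  constructor
  · rintro (⟨k, hk, rfl⟩ | ⟨k, hk, rfl⟩)
    · exact Or.inl ⟨_, ⟨k, hk, rfl⟩, rfl⟩
    · exact Or.inr ⟨_, ⟨k, hk, rfl⟩, rfl⟩
  · rintro (⟨_, ⟨k, hk, rfl⟩, rfl⟩ | ⟨_, ⟨k, hk, rfl⟩, rfl⟩)
    · exact Or.inl ⟨k, hk, rfl⟩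
    · exact Or.inr ⟨k, hk, rfl⟩

open ComplexConjugate in
lemma Complex.conj_pow_eq_one {m : ℕ} {w : ℂ} (hw : w ^ m = 1) : conj w ^ m = 1 := by
  rw [← map_pow, hw, map_one]

lemma ncard_setOf_pow_eq_one {m : ℕ} (hm : m ≠ 0) : {w : ℂ | w ^ m = 1}.ncard = m := by
  have h : {w : ℂ | w ^ m = 1} = ↑(Polynomial.nthRootsFinset m (1 : ℂ)) := by
    ext w
    simp [Polynomial.mem_nthRootsFinset (Nat.pos_of_ne_zero hm)]
  rw [h, Set.ncard_coe_finset, (Complex.isPrimitiveRoot_exp m hm).card_nthRootsFinset]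

lemma finite_setOf_pow_eq_one {m : ℕ} (hm : m ≠ 0) : {w : ℂ | w ^ m = 1}.Finite :=
  Set.finite_of_ncard_ne_zero (by rwa [ncard_setOf_pow_eq_one hm])

open ComplexConjugate in
lemma two_mul_ncard_roots_im_pos {m : ℕ} (hm : m ≠ 0) :
    2 * {w : ℂ | w ^ m = 1 ∧ 0 < w.im}.ncard = if Even m then m - 2 else m - 1 := by
  have hfin := finite_setOf_pow_eq_one hm
  have hconj : {w : ℂ | w ^ m = 1 ∧ w.im < 0} = conj '' {w : ℂ | w ^ m = 1 ∧ 0 < w.im} := by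
    ext w
    constructor
    · rintro ⟨h, h'⟩
      exact ⟨conj w, ⟨Complex.conj_pow_eq_one h, by simpa using h'⟩, Complex.conj_conj w⟩
    · rintro ⟨x, ⟨h, h'⟩, rfl⟩
      exact ⟨Complex.conj_pow_eq_one h, by simpa using h'⟩
  have hneg : {w : ℂ | w ^ m = 1 ∧ w.im < 0}.ncard = {w : ℂ | w ^ m = 1 ∧ 0 < w.im}.ncard := by
    rw [hconj, Set.ncard_image_of_injective _ (RingHom.injective _)]
  have hreal : {w : ℂ | w ^ m = 1 ∧ w.im = 0} = if Even m then {1, -1} else {1} := by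
    ext w
    have h1 : w ^ m = 1 ∧ w.im = 0 ↔ w = 1 ∨ (w = -1 ∧ Even m) := by
      constructor
      · rintro ⟨h, h'⟩
        have hn := Complex.normSq_eq_one_of_pow_eq_one hm h
        rw [Complex.normSq_apply, h', mul_zero, add_zero, mul_self_eq_one_iff] at hn
        rcases hn with hn | hn
        · exact Or.inl (Complex.ext hn h')
        · have hw : w = -1 := Complex.ext (by simpa using hn) (by simpa using h')
          refine Or.inr ⟨hw, ?_⟩
          by_contra hodd
          rw [hw, (Nat.not_even_iff_odd.mp hodd).neg_one_pow] at h
          norm_num at h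
      · rintro (rfl | ⟨rfl, he⟩)
        · simp
        · simp [he.neg_one_pow]
    rw [Set.mem_ofPred_eq, h1]
    split_ifs with he <;> simp [he]
  have hreal' : {w : ℂ | w ^ m = 1 ∧ w.im = 0}.ncard = if Even m then 2 else 1 := by
    rw [hreal]
    split_ifs with he
    · exact Set.ncard_pair (by norm_num)
    · exact Set.ncard_singleton _
  have hsplit : {w : ℂ | w ^ m = 1} = {w : ℂ | w ^ m = 1 ∧ 0 < w.im} ∪
      ({w : ℂ | w ^ m = 1 ∧ w.im < 0} ∪ {w : ℂ | w ^ m = 1 ∧ w.im = 0}) := by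
    ext w
    simp only [Set.mem_union, Set.mem_ofPred_eq, ← and_or_left, iff_self_and]
    intro _
    rcases lt_trichotomy w.im 0 with h | h | h <;> simp [h]
  have hcard := ncard_setOf_pow_eq_one hm
  rw [hsplit, Set.ncard_union_eq _ (hfin.subset fun w h => h.1)
      ((hfin.subset fun w h => h.1).union (hfin.subset fun w h => h.1)),
    Set.ncard_union_eq _ (hfin.subset fun w h => h.1) (hfin.subset fun w h => h.1),
    hneg, hreal'] at hcard
  · split_ifs at hcard ⊢ <;> omega
  · rw [Set.disjoint_left]
    rintro w ⟨-, h⟩ ⟨-, h'⟩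
    linarith
  · rw [Set.disjoint_left]
    rintro w ⟨-, h⟩ (⟨-, h'⟩ | ⟨-, h'⟩) <;> linarith

open ComplexConjugate in
lemma tangentGenCircle_inter_alignedDoublePolygon {m : ℕ} (hm : m ≠ 0) {r : ℝ} (hr : 1 < r)
    (b : Bool) {u v : ℂ} (hu : u ^ m = 1) (hv : v ^ m = 1) :
    tangentGenCircle (doublePolygonRadius r b) (doublePolygonRadius r (!b)) u v ∩
        alignedDoublePolygon m r =
      {(doublePolygonRadius r b : ℂ) * u, (doublePolygonRadius r (!b) : ℂ) * (u * v),
        (doublePolygonRadius r (!b) : ℂ) * (u * conj v)} := by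
  have hpq := doublePolygonRadius_sq_ne hr b
  have hp := doublePolygonRadius_pos hr b
  have hq := doublePolygonRadius_pos hr (!b)
  have hun := Complex.normSq_eq_one_of_pow_eq_one hm hu
  have hvn := Complex.normSq_eq_one_of_pow_eq_one hm hv
  have h1 : (u * v) ^ m = 1 := by rw [mul_pow, hu, hv, one_mul]
  have h2 : (u * conj v) ^ m = 1 := by rw [mul_pow, hu, Complex.conj_pow_eq_one hv, one_mul]
  ext z
  simp only [Set.mem_inter_iff, Set.mem_insert_iff, Set.mem_singleton_iff,
    mem_alignedDoublePolygon hm]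
  constructor
  · rintro ⟨hz, b', w, hw, rfl⟩
    have hwn := Complex.normSq_eq_one_of_pow_eq_one hm hw
    rcases Bool.eq_or_eq_not b' b with rfl | rfl
    · rw [mul_mem_tangentGenCircle_self_iff hp hpq hun hwn] at hz
      simp [hz]
    · rw [mul_mem_tangentGenCircle_iff hq hpq hun hvn hwn] at hz
      rcases hz with hz | hz <;> simp [hz]
  · rintro (rfl | rfl | rfl)
    · exact ⟨(mul_mem_tangentGenCircle_self_iff hp hpq hun hun).mpr rfl, _, _, hu, rfl⟩
    · exact ⟨(mul_mem_tangentGenCircle_iff hq hpq hun hvn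
        (Complex.normSq_eq_one_of_pow_eq_one hm h1)).mpr (Or.inl rfl), _, _, h1, rfl⟩
    · exact ⟨(mul_mem_tangentGenCircle_iff hq hpq hun hvn
        (Complex.normSq_eq_one_of_pow_eq_one hm h2)).mpr (Or.inr rfl), _, _, h2, rfl⟩

open ComplexConjugate in
lemma ncard_tangentGenCircle_inter_alignedDoublePolygon {m : ℕ} (hm : m ≠ 0) {r : ℝ}
    (hr : 1 < r) (b : Bool) {u v : ℂ} (hu : u ^ m = 1) (hv : v ^ m = 1) (hv' : 0 < v.im) :
    (tangentGenCircle (doublePolygonRadius r b) (doublePolygonRadius r (!b)) u v ∩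
        alignedDoublePolygon m r).ncard = 3 := by
  have hun := Complex.normSq_eq_one_of_pow_eq_one hm hu
  have hvn := Complex.normSq_eq_one_of_pow_eq_one hm hv
  have h1 : Complex.normSq (u * v) = 1 := by rw [Complex.normSq_mul, hun, hvn, one_mul]
  have h2 : Complex.normSq (u * conj v) = 1 := by
    rw [Complex.normSq_mul, Complex.normSq_conj, hun, hvn, one_mul]
  have hu0 : u ≠ 0 := by
    rintro rfl
    simp at hun
  rw [tangentGenCircle_inter_alignedDoublePolygon hm hr b hu hv]
  refine Set.ncard_eq_three.mpr ⟨_, _, _, ?_, ?_, ?_, rfl⟩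
  · rw [Ne, doublePolygonRadius_mul_inj hr hun h1]
    simp
  · rw [Ne, doublePolygonRadius_mul_inj hr hun h2]
    simp
  · rw [Ne, doublePolygonRadius_mul_inj hr h1 h2]
    rintro ⟨-, h⟩
    have h3 := congrArg Complex.im (mul_left_cancel₀ hu0 h)
    rw [Complex.conj_im] at h3
    linarith

open ComplexConjugate in
lemma tangentGenCircle_injOn {m : ℕ} (hm : m ≠ 0) {r : ℝ} (hr : 1 < r) :
    Set.InjOn (fun x : Bool × ℂ × ℂ =>
        tangentGenCircle (doublePolygonRadius r x.1) (doublePolygonRadius r (!x.1)) x.2.1 x.2.2)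
      (Set.univ ×ˢ {w : ℂ | w ^ m = 1} ×ˢ {w : ℂ | w ^ m = 1 ∧ 0 < w.im}) := by
  rintro ⟨b, u, v⟩ ⟨-, hu, hv, hv'⟩ ⟨b', u', v'⟩ ⟨-, hx, hy, hy'⟩ h
  simp only [Set.mem_ofPred_eq] at hu hv hv' hx hy hy' h
  have hun := Complex.normSq_eq_one_of_pow_eq_one hm hu
  have hvn := Complex.normSq_eq_one_of_pow_eq_one hm hv
  have hxn := Complex.normSq_eq_one_of_pow_eq_one hm hx
  have hyn := Complex.normSq_eq_one_of_pow_eq_one hm hy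
  have h1 : Complex.normSq (u * v) = 1 := by rw [Complex.normSq_mul, hun, hvn, one_mul]
  have h2 : Complex.normSq (u * conj v) = 1 := by
    rw [Complex.normSq_mul, Complex.normSq_conj, hun, hvn, one_mul]
  have hu0 : u ≠ 0 := by
    rintro rfl
    simp at hun
  have hpq := doublePolygonRadius_sq_ne hr b
  have hp := doublePolygonRadius_pos hr b
  have hq := doublePolygonRadius_pos hr (!b)
  have m0 := (mul_mem_tangentGenCircle_self_iff (v := v) hp hpq hun hun).mpr rfl
  have m1 := (mul_mem_tangentGenCircle_iff hq hpq hun hvn h1).mpr (Or.inl rfl)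
  have m2 := (mul_mem_tangentGenCircle_iff hq hpq hun hvn h2).mpr (Or.inr rfl)
  rw [h] at m0 m1 m2
  rcases Bool.eq_or_eq_not b' b with rfl | rfl
  · rw [mul_mem_tangentGenCircle_self_iff hp hpq hxn hun] at m0
    subst m0
    rw [mul_mem_tangentGenCircle_iff hq hpq hun hyn h1] at m1
    rcases m1 with m1 | m1
    · rw [mul_left_cancel₀ hu0 m1]
    · have h3 := congrArg Complex.im (mul_left_cancel₀ hu0 m1)
      rw [Complex.conj_im] at h3
      linarith
  · have hpq' := doublePolygonRadius_sq_ne hr (!b)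
    rw [mul_mem_tangentGenCircle_self_iff hq hpq' hxn h1] at m1
    rw [mul_mem_tangentGenCircle_self_iff hq hpq' hxn h2] at m2
    have h3 := congrArg Complex.im (mul_left_cancel₀ hu0 (m1.trans m2.symm))
    rw [Complex.conj_im] at h3
    linarith

open ComplexConjugate in
/-- A generalised circle meeting the aligned double polygon in exactly three points, two of which
have the same absolute value, is tangent to one of the two circumscribed circles. -/
lemma exists_eq_tangentGenCircle {m : ℕ} (hm : m ≠ 0) {r : ℝ} (hr : 1 < r)
    {A D : ℝ} {B : ℂ} (hB : B ≠ 0) {K : Set ℂ}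
    (hK : K = {z | A * Complex.normSq z + (z * conj B).re + D = 0})
    {b b' : Bool} {x y u : ℂ} (hx : x ^ m = 1) (hy : y ^ m = 1) (hu : u ^ m = 1)
    (hinter : K ∩ alignedDoublePolygon m r = {(doublePolygonRadius r b : ℂ) * x,
      (doublePolygonRadius r b : ℂ) * y, (doublePolygonRadius r b' : ℂ) * u})
    (hxy : (doublePolygonRadius r b : ℂ) * x ≠ doublePolygonRadius r b * y)
    (hxu : (doublePolygonRadius r b : ℂ) * x ≠ doublePolygonRadius r b' * u)
    (hyu : (doublePolygonRadius r b : ℂ) * y ≠ doublePolygonRadius r b' * u) :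
    ∃ v : ℂ, (v ^ m = 1 ∧ 0 < v.im) ∧
      tangentGenCircle (doublePolygonRadius r b') (doublePolygonRadius r (!b')) u v = K := by
  have hxn := Complex.normSq_eq_one_of_pow_eq_one hm hx
  have hyn := Complex.normSq_eq_one_of_pow_eq_one hm hy
  have hun := Complex.normSq_eq_one_of_pow_eq_one hm hu
  have hxx := Complex.mul_conj_eq_one_of_normSq_eq_one hxn
  have huu := Complex.mul_conj_eq_one_of_normSq_eq_one hun
  rw [Ne, doublePolygonRadius_mul_inj hr hxn hyn] at hxy
  rw [Ne, doublePolygonRadius_mul_inj hr hxn hun] at hxu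
  rw [Ne, doublePolygonRadius_mul_inj hr hyn hun] at hyu
  have hmem (c : Bool) (w : ℂ) (hw : Complex.normSq w = 1) :
      (doublePolygonRadius r c : ℂ) * w ∈ K ↔ A * doublePolygonRadius r c ^ 2 +
        doublePolygonRadius r c * (w * conj B).re + D = 0 := by
    rw [hK, Set.mem_ofPred_eq, Complex.normSq_mul, hw, Complex.normSq_ofReal,
      mul_assoc _ w, Complex.re_ofReal_mul, mul_one, pow_two]
  have hre (c : Bool) (w t : ℂ) (hw : Complex.normSq w = 1) (ht : Complex.normSq t = 1)
      (hwK : (doublePolygonRadius r c : ℂ) * w ∈ K)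
      (htK : (doublePolygonRadius r c : ℂ) * t ∈ K) (hwt : w ≠ t) : w * t * conj B = B := by
    rw [hmem c w hw] at hwK
    rw [hmem c t ht] at htK
    have h1 : (w * conj B).re = (t * conj B).re :=
      mul_left_cancel₀ (doublePolygonRadius_pos hr c).ne' (by linarith)
    rcases Complex.eq_or_eq_conj_of_normSq_eq_of_re_eq
      (by rw [Complex.normSq_mul, Complex.normSq_mul, hw, ht]) h1 with h | h
    · exact absurd (mul_right_cancel₀ ((map_ne_zero _).mpr hB) h) hwt
    · rw [map_mul, Complex.conj_conj] at h
      linear_combination t * h + B * Complex.mul_conj_eq_one_of_normSq_eq_one ht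
  have hxK : (doublePolygonRadius r b : ℂ) * x ∈ K :=
    (hinter.symm.subset (by simp) : _ ∈ K ∩ alignedDoublePolygon m r).1
  have hyK : (doublePolygonRadius r b : ℂ) * y ∈ K :=
    (hinter.symm.subset (by simp) : _ ∈ K ∩ alignedDoublePolygon m r).1
  have huK : (doublePolygonRadius r b' : ℂ) * u ∈ K :=
    (hinter.symm.subset (by simp) : _ ∈ K ∩ alignedDoublePolygon m r).1
  have hne : x ≠ y := fun h => hxy ⟨rfl, h⟩
  have hs := hre b x y hxn hyn hxK hyK hne
  obtain rfl : b = !b' := by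
    rcases Bool.eq_or_eq_not b b' with rfl | h
    · have h1 := hre b x u hxn hun hxK huK fun h => hxu ⟨rfl, h⟩
      have h2 : x * (y - u) * conj B = 0 := by linear_combination hs - h1
      have hx0 : x ≠ 0 := by
        rintro rfl
        simp at hxn
      have h3 : y - u = 0 := by simpa [hx0, hB] using h2
      exact absurd ⟨rfl, sub_eq_zero.mp h3⟩ hyu
    · exact h
  have hsq : x * y = u ^ 2 := by
    have h4 : (x * y * conj u) ^ m = 1 := by
      rw [mul_pow, mul_pow, hx, hy, Complex.conj_pow_eq_one hu, one_mul, one_mul]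
    have h4n := Complex.normSq_eq_one_of_pow_eq_one hm h4
    have h4K : (doublePolygonRadius r b' : ℂ) * (x * y * conj u) ∈ K := by
      rw [hmem _ _ hun] at huK
      rw [hmem _ _ h4n]
      have : (x * y * conj u * conj B).re = (u * conj B).re := by
        rw [← Complex.conj_re (u * conj B), map_mul, Complex.conj_conj]
        congr 1
        linear_combination conj u * hs
      rw [this, huK]
    have h4S : (doublePolygonRadius r b' : ℂ) * (x * y * conj u) ∈
        K ∩ alignedDoublePolygon m r :=
      ⟨h4K, (mem_alignedDoublePolygon hm).mpr ⟨_, _, h4, rfl⟩⟩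
    rw [hinter, Set.mem_insert_iff, Set.mem_insert_iff, Set.mem_singleton_iff,
      doublePolygonRadius_mul_inj hr h4n hxn, doublePolygonRadius_mul_inj hr h4n hyn,
      doublePolygonRadius_mul_inj hr h4n hun] at h4S
    rcases h4S with h | h | h
    · simp at h
    · simp at h
    · linear_combination u * h.2 - x * y * huu
  obtain ⟨β, rfl⟩ : ∃ β : ℝ, B = β * u := by
    have h1 : conj (B * conj u) = B * conj u := by
      rw [map_mul, Complex.conj_conj]
      rw [hsq] at hs
      linear_combination conj u * hs - u * conj B * huu
    obtain ⟨β, hβ⟩ := Complex.conj_eq_iff_real.mp h1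
    exact ⟨β, by linear_combination u * hβ - B * huu⟩
  have hβ : β ≠ 0 := by
    rintro rfl
    simp at hB
  have hR (z : ℂ) : (z * conj ((β : ℂ) * u)).re = β * (z * conj u).re := by
    rw [map_mul, Complex.conj_ofReal, mul_left_comm, Complex.re_ofReal_mul]
  have hpow : (x * conj u) ^ m = 1 := by
    rw [mul_pow, hx, Complex.conj_pow_eq_one hu, one_mul]
  have him : (x * conj u).im ≠ 0 := by
    intro h
    have h1 : conj (x * conj u) = x * conj u := Complex.conj_eq_iff_im.mpr h
    rw [map_mul, Complex.conj_conj] at h1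
    apply hne
    have h2 : x * x = u ^ 2 := by
      linear_combination (-x * u) * h1 + u ^ 2 * hxx - x * x * huu
    exact mul_left_cancel₀ (left_ne_zero_of_mul_eq_one hxx) (h2.trans hsq.symm)
  obtain ⟨v, hv, hv', hvre⟩ : ∃ v : ℂ, v ^ m = 1 ∧ 0 < v.im ∧ v.re = (x * conj u).re := by
    rcases him.lt_or_gt with h | h
    · exact ⟨conj (x * conj u), Complex.conj_pow_eq_one hpow,
        by rw [Complex.conj_im]; linarith, Complex.conj_re _⟩
    · exact ⟨_, hpow, h, rfl⟩
  refine ⟨v, ⟨hv, hv'⟩, ?_⟩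
  rw [hmem _ _ hxn, hR, ← hvre] at hxK
  rw [hmem _ _ hun, hR, huu, Complex.one_re] at huK
  have hpq := sub_ne_zero.mpr (doublePolygonRadius_sq_ne hr b')
  ext z
  rw [hK, Set.mem_ofPred_eq, hR, tangentGenCircle, Set.mem_ofPred_eq]
  generalize doublePolygonRadius r b' = p at *
  generalize doublePolygonRadius r (!b') = q at *
  generalize (z * conj u).re = R
  generalize Complex.normSq z = N
  constructor
  · intro h
    refine (mul_eq_zero.mp (?_ : (p ^ 2 - q ^ 2) * _ = 0)).resolve_left hpq
    linear_combination (-β) * h + (N - q ^ 2) * huK - (N - p ^ 2) * hxK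
  · intro h
    refine mul_left_cancel₀ hβ ?_
    linear_combination (-(p ^ 2 - q ^ 2)) * h + (N - q ^ 2) * huK - (N - p ^ 2) * hxK

lemma setOf_ordinary_eq_image_tangentGenCircle {m : ℕ} (hm : 4 ≤ m) {r : ℝ} (hr : 1 < r) :
    {C : Set ℂ | IsGenCircle C ∧ (C ∩ alignedDoublePolygon m r).ncard = 3} =
      (fun x : Bool × ℂ × ℂ =>
        tangentGenCircle (doublePolygonRadius r x.1) (doublePolygonRadius r (!x.1)) x.2.1 x.2.2) ''
      (Set.univ ×ˢ {w : ℂ | w ^ m = 1} ×ˢ {w : ℂ | w ^ m = 1 ∧ 0 < w.im}) := by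
  have hm0 : m ≠ 0 := by omega
  ext K
  constructor
  · rintro ⟨hgen, hcard⟩
    obtain ⟨A, B, D, hK⟩ := hgen.exists_equation_s18
    obtain ⟨z₁, z₂, z₃, h12, h13, h23, hinter⟩ := Set.ncard_eq_three.mp hcard
    have hmem (z : ℂ) (hz : z ∈ ({z₁, z₂, z₃} : Set ℂ)) : z ∈ K ∧
        ∃ (b : Bool) (w : ℂ), w ^ m = 1 ∧ z = doublePolygonRadius r b * w := by
      rw [← hinter] at hz
      exact ⟨hz.1, (mem_alignedDoublePolygon hm0).mp hz.2⟩
    obtain ⟨hz₁, b₁, w₁, hw₁, rfl⟩ := hmem z₁ (by simp)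
    obtain ⟨-, b₂, w₂, hw₂, rfl⟩ := hmem z₂ (by simp)
    obtain ⟨-, b₃, w₃, hw₃, rfl⟩ := hmem z₃ (by simp)
    have hB : B ≠ 0 := by
      rintro rfl
      have hsub : (fun w : ℂ => (doublePolygonRadius r b₁ : ℂ) * w) '' {w : ℂ | w ^ m = 1} ⊆
          K ∩ alignedDoublePolygon m r := by
        rintro _ ⟨w, hw, rfl⟩
        refine ⟨?_, (mem_alignedDoublePolygon hm0).mpr ⟨_, _, hw, rfl⟩⟩
        rw [hK] at hz₁ ⊢
        simpa [Complex.normSq_eq_one_of_pow_eq_one hm0 hw₁,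
          Complex.normSq_eq_one_of_pow_eq_one hm0 hw] using hz₁
      have hle := Set.ncard_le_ncard hsub (Set.finite_of_ncard_ne_zero (by omega))
      rw [Set.ncard_image_of_injective _ (mul_right_injective₀
        (Complex.ofReal_ne_zero.mpr (doublePolygonRadius_pos hr b₁).ne')),
        ncard_setOf_pow_eq_one hm0] at hle
      omega
    have hpair : b₁ = b₂ ∨ b₁ = b₃ ∨ b₂ = b₃ := by
      clear * -
      decide +revert
    rcases hpair with rfl | rfl | rfl
    · obtain ⟨v, hv, rfl⟩ := exists_eq_tangentGenCircle hm0 hr hB hK hw₁ hw₂ hw₃ hinter h12 h13 h23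
      exact ⟨(b₃, w₃, v), ⟨trivial, hw₃, hv⟩, rfl⟩
    · rw [Set.pair_comm] at hinter
      obtain ⟨v, hv, rfl⟩ :=
        exists_eq_tangentGenCircle hm0 hr hB hK hw₁ hw₃ hw₂ hinter h13 h12 h23.symm
      exact ⟨(b₂, w₂, v), ⟨trivial, hw₂, hv⟩, rfl⟩
    · rw [Set.insert_comm, Set.pair_comm (_ * w₁)] at hinter
      obtain ⟨v, hv, rfl⟩ :=
        exists_eq_tangentGenCircle hm0 hr hB hK hw₂ hw₃ hw₁ hinter h23 h12.symm h13.symm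
      exact ⟨(b₁, w₁, v), ⟨trivial, hw₁, hv⟩, rfl⟩
  · rintro ⟨⟨b, u, v⟩, ⟨-, hu, hv, hv'⟩, rfl⟩
    refine ⟨?_, ncard_tangentGenCircle_inter_alignedDoublePolygon hm0 hr b hu hv hv'⟩
    refine isGenCircle_tangentGenCircle (doublePolygonRadius_pos hr b)
      (doublePolygonRadius_sq_ne hr b) (Complex.normSq_eq_one_of_pow_eq_one hm0 hu) ?_
    have h1 := Complex.normSq_eq_one_of_pow_eq_one hm0 hv
    rw [Complex.normSq_apply] at h1
    have h2 := mul_pos hv' hv'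
    simp only
    linarith

/-- The aligned double `m`-gon (`m ≥ 4`, radii `1` and `r > 1`) determines exactly
`m(m−2)` ordinary generalised circles if `m` is even, and `m(m−1)` if `m` is odd. -/
theorem ordinary_gen_circles_aligned_double_polygon
    (m : ℕ) (hm : 4 ≤ m) (r : ℝ) (hr : 1 < r) :
    ordinaryGenCircles (alignedDoublePolygon m r) =
      if Even m then m * (m - 2) else m * (m - 1) := by
  have hm0 : m ≠ 0 := by omega
  rw [ordinaryGenCircles, setOf_ordinary_eq_image_tangentGenCircle hm hr,
    (tangentGenCircle_injOn hm0 hr).ncard_image, Set.ncard_prod, Set.ncard_prod,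
    ncard_setOf_pow_eq_one hm0, Set.ncard_univ, Nat.card_eq_fintype_card, Fintype.card_bool,
    mul_left_comm, two_mul_ncard_roots_im_pos hm0, mul_ite]
end
end
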